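/- arXiv:2109.07313 — 3 statements merged into one kernel-verified Lean document; each statement's English description precedes it below -/
import Mathlib

section
/- For every instance with 3 agents, a finite set M of indivisible chores, and additive nonnegative cost functions, there exists a 5-EFX allocation; that is, an allocation (X_1, X_2, X_3) of M such that for all agents i, j ∈ {1,2,3} and every item e ∈ X_i it holds that c_i(X_i \ {e}) ≤ 5·c_i(X_j). -/
open Finset

section Chores

variable {ι : Type*}

/-- The additive cost of a bundle. -/
def cost (f : ι → ℝ) (S : Finset ι) : ℝ := ∑ x ∈ S, f x

section Cost

variable {f : ι → ℝ} {S T : Finset ι} {e : ι}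

@[simp] lemma cost_empty : cost f ∅ = 0 := by simp [cost]

@[simp] lemma cost_singleton : cost f {e} = f e := by simp [cost]

lemma cost_nonneg (hf : ∀ x, 0 ≤ f x) (S : Finset ι) : 0 ≤ cost f S :=
  sum_nonneg fun x _ => hf x

lemma cost_mono (hf : ∀ x, 0 ≤ f x) (h : S ⊆ T) : cost f S ≤ cost f T :=
  sum_le_sum_of_subset_of_nonneg h fun x _ _ => hf x

lemma le_cost (hf : ∀ x, 0 ≤ f x) (h : e ∈ S) : f e ≤ cost f S :=
  single_le_sum (fun x _ => hf x) h

end Cost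

variable [DecidableEq ι]

/-- An agent with cost function `f` who owns `S` has no `5`-EFX envy towards `T`. -/
def Content (f : ι → ℝ) (S T : Finset ι) : Prop :=
  ∀ e ∈ S, cost f (S.erase e) ≤ 5 * cost f T

/-- `X`, `Y`, `Z` partition `M`. -/
def IsSplit (X Y Z M : Finset ι) : Prop :=
  Disjoint X Y ∧ Disjoint X Z ∧ Disjoint Y Z ∧ X ∪ Y ∪ Z = M

/-- There is a `5`-EFX allocation of `M` among agents with cost functions `a`, `b`, `c`. -/
def HasEFX (a b c : ι → ℝ) (M : Finset ι) : Prop :=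
  ∃ X Y Z, IsSplit X Y Z M ∧ Content a X Y ∧ Content a X Z ∧ Content b Y X ∧ Content b Y Z ∧
    Content c Z X ∧ Content c Z Y

lemma HasEFX.swap {a b c : ι → ℝ} {M : Finset ι} (h : HasEFX a c b M) : HasEFX a b c M := by
  obtain ⟨X, Y, Z, ⟨h1, h2, h3, h4⟩, h5, h6, h7, h8, h9, h10⟩ := h
  exact ⟨X, Z, Y, ⟨h2, h1, h3.symm, by rw [← h4, union_right_comm]⟩, h6, h5, h9, h10, h7, h8⟩

section Cost

variable {f : ι → ℝ} {S T : Finset ι} {e : ι}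

lemma cost_union (h : Disjoint S T) : cost f (S ∪ T) = cost f S + cost f T := sum_union h

lemma cost_union_le (hf : ∀ x, 0 ≤ f x) (S T : Finset ι) :
    cost f (S ∪ T) ≤ cost f S + cost f T := by
  have h : cost f (S ∪ T) + cost f (S ∩ T) = cost f S + cost f T := sum_union_inter
  linarith [cost_nonneg hf (S ∩ T)]

lemma cost_insert (h : e ∉ S) : cost f (insert e S) = f e + cost f S := sum_insert h

lemma cost_insert_le (hf : ∀ x, 0 ≤ f x) (e : ι) (S : Finset ι) :
    cost f (insert e S) ≤ f e + cost f S := by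
  rw [insert_eq]
  exact (cost_union_le hf {e} S).trans_eq (by rw [cost_singleton])

lemma cost_erase (h : e ∈ S) : cost f (S.erase e) = cost f S - f e := sum_erase_eq_sub h

lemma cost_sdiff (h : S ⊆ T) : cost f (T \ S) = cost f T - cost f S := by
  have := sum_sdiff (f := f) h
  unfold cost
  linarith

lemma content_of_le (hf : ∀ x, 0 ≤ f x) (h : cost f S ≤ 5 * cost f T) : Content f S T :=
  fun e _ => (cost_mono hf (erase_subset e S)).trans h

lemma content_singleton (hf : ∀ x, 0 ≤ f x) : Content f {e} T := by
  intro x hx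
  obtain rfl := mem_singleton.1 hx
  simpa using cost_nonneg hf T

lemma Content.mono {S' T' : Finset ι} (h : Content f S T) (hf : ∀ x, 0 ≤ f x) (hS : S' ⊆ S)
    (hT : T ⊆ T') : Content f S' T' := fun e he =>
  ((cost_mono hf (erase_subset_erase e hS)).trans (h e (hS he))).trans
    (by linarith [cost_mono hf hT])

/-- An envious agent strictly prefers the other bundle and owns at least two chores. -/
lemma lt_and_nontrivial_of_not_content (hf : ∀ x, 0 ≤ f x) (h : ¬ Content f S T) :
    5 * cost f T < cost f S ∧ S.Nontrivial := by
  simp only [Content, not_forall, not_le] at h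
  obtain ⟨e, he, h⟩ := h
  refine ⟨h.trans_le (cost_mono hf (erase_subset e S)), ?_⟩
  by_contra hS
  have : S.erase e = ∅ := by
    rw [erase_eq_empty_iff]
    exact (or_iff_right (ne_empty_of_mem he)).2
      (eq_singleton_iff_unique_mem.2 ⟨he, fun x hx => (Set.not_nontrivial_iff.1 hS) hx he⟩)
  rw [this, cost_empty] at h
  linarith [cost_nonneg hf T]

end Cost

/-- Two agents `b`, `c` can divide `A ∪ B` so that a third agent `a` sees a third of the smaller
part in each bundle, unless `b` and `c` agree on a dominating chore that is cheap for `a`. -/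
lemma exists_division_or_dominating {a b c : ι → ℝ} (ha : ∀ x, 0 ≤ a x) (hb : ∀ x, 0 ≤ b x)
    (hc : ∀ x, 0 ≤ c x) {A B : Finset ι} (hAB : Disjoint A B) {ρ : ℝ}
    (hA : 3 * ρ ≤ cost a A) (hB : 3 * ρ ≤ cost a B) :
    (∃ Y Z, Disjoint Y Z ∧ Y ∪ Z = A ∪ B ∧ Content b Y Z ∧ Content c Z Y ∧
      ρ ≤ cost a Y ∧ ρ ≤ cost a Z) ∨
    ∃ f ∈ A ∪ B, a f < ρ ∧ 2 * cost b ((A ∪ B).erase f) < b f ∧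
      2 * cost c ((A ∪ B).erase f) < c f := by
  set T := A ∪ B with hT
  have hcA := cost_nonneg ha A
  have hcB := cost_nonneg ha B
  by_contra hcon
  push Not at hcon
  obtain ⟨hno, hdom⟩ := hcon
  -- `heavy S`: both agents envy from `S` towards its complement
  let heavy : Finset ι → Prop := fun S =>
    5 * cost b (T \ S) < cost b S ∧ 5 * cost c (T \ S) < cost c S ∧ S.Nontrivial
  have key : ∀ S ⊆ T, ρ ≤ cost a S → ρ ≤ cost a (T \ S) → heavy S ∨ heavy (T \ S) := by
    intro S hS h1 h2
    have hTS : T \ (T \ S) = S := Finset.sdiff_sdiff_eq_self hS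
    by_cases hb1 : Content b S (T \ S)
    · by_cases hc1 : Content c (T \ S) S
      · exact absurd h2 (not_le.2
          (hno S (T \ S) disjoint_sdiff (union_sdiff_of_subset hS) hb1 hc1 h1))
      · obtain ⟨hc2, hn⟩ := lt_and_nontrivial_of_not_content hc hc1
        by_cases hb2 : Content b (T \ S) S
        · by_cases hc3 : Content c S (T \ S)
          · exact absurd h1 (not_le.2 (hno (T \ S) S disjoint_sdiff.symm
              (sdiff_union_of_subset hS) hb2 hc3 h2))
          · have := (lt_and_nontrivial_of_not_content hc hc3).1
            linarith [cost_nonneg hc S, cost_nonneg hc (T \ S)]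
        · have := (lt_and_nontrivial_of_not_content hb hb2).1
          right
          simp only [heavy, hTS]
          exact ⟨this, hc2, hn⟩
    · obtain ⟨hb2, hn⟩ := lt_and_nontrivial_of_not_content hb hb1
      have hb3 : Content b (T \ S) S := content_of_le hb
        (by linarith [cost_nonneg hb S, cost_nonneg hb (T \ S)])
      by_cases hc3 : Content c S (T \ S)
      · exact absurd h1 (not_le.2 (hno (T \ S) S disjoint_sdiff.symm
          (sdiff_union_of_subset hS) hb3 hc3 h2))
      · exact Or.inl ⟨hb2, (lt_and_nontrivial_of_not_content hc hc3).1, hn⟩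
  -- a chore in which two heavy sets essentially meet is dominating
  have pivot : ∀ S S' : Finset ι, ∀ g ∈ T, S ⊆ T → S' ⊆ T → heavy S → heavy S' →
      S ∩ S' ⊆ {g} → a g < ρ → False := by
    intro S S' g hg hS hS' h h' hSS hag
    have aux : ∀ f : ι → ℝ, (∀ x, 0 ≤ f x) → 5 * cost f (T \ S) < cost f S →
        5 * cost f (T \ S') < cost f S' → 2 * cost f (T.erase g) < f g := by
      intro f hf h1 h2
      rw [cost_sdiff hS] at h1
      rw [cost_sdiff hS'] at h2
      rw [cost_erase hg]
      have h3 : cost f (S ∪ S') + cost f (S ∩ S') = cost f S + cost f S' := sum_union_inter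
      have h4 := cost_mono hf hSS
      have h5 := cost_mono hf (union_subset hS hS')
      rw [cost_singleton] at h4
      linarith
    exact absurd (aux c hc h.2.1 h'.2.1) (not_lt.2 (hdom g hg hag (aux b hb h.1 h'.1)))
  have not_both : ∀ S S' : Finset ι, S ⊆ T → S' ⊆ T → heavy S → heavy S' → ¬ Disjoint S S' := by
    intro S S' hS hS' h h' hd
    have h1 := h.1
    have h2 := h'.1
    rw [cost_sdiff hS] at h1
    rw [cost_sdiff hS'] at h2
    have h3 := cost_mono hb (union_subset hS hS')
    rw [cost_union hd] at h3
    linarith [cost_nonneg hb S, cost_nonneg hb S', cost_nonneg hb T]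
  have hTA : T \ A = B := by rw [hT, union_sdiff_cancel_left hAB]
  -- a smallest heavy set leaving enough on both sides
  obtain ⟨H, hHmem, hHmin⟩ := exists_min_image
    (T.powerset.filter fun S => heavy S ∧ ρ ≤ cost a S ∧ ρ ≤ cost a (T \ S)) card (by
      have hρA : ρ ≤ cost a A := by by_contra; linarith
      have hρB : ρ ≤ cost a B := by by_contra; linarith
      have hTB : T \ B = A := by rw [hT, union_sdiff_cancel_right hAB]
      rcases key A subset_union_left hρA (by rwa [hTA]) with h | h
      · exact ⟨A, by simp [h, hρA, hρB, hTA, show A ⊆ T from subset_union_left]⟩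
      · rw [hTA] at h
        exact ⟨B, by simp [h, hρA, hρB, hTB, show B ⊆ T from subset_union_right]⟩)
  simp only [mem_filter, mem_powerset] at hHmem hHmin
  obtain ⟨hHT, hH, hHa, hHa'⟩ := hHmem
  obtain ⟨g₁, hg₁, g₂, hg₂, hne⟩ := hH.2.2
  by_cases hmov : ∃ g ∈ H, ρ ≤ cost a (H.erase g)
  · obtain ⟨g, hg, hgρ⟩ := hmov
    have hsub : H.erase g ⊆ T := (erase_subset g H).trans hHT
    have hcompl : ρ ≤ cost a (T \ H.erase g) :=
      hHa'.trans (cost_mono ha (sdiff_subset_sdiff le_rfl (erase_subset g H)))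
    rcases key _ hsub hgρ hcompl with h | h
    · have := hHmin _ ⟨hsub, h, hgρ, hcompl⟩
      have := card_erase_lt_of_mem hg
      omega
    · refine pivot H (T \ H.erase g) g (hHT hg) hHT sdiff_subset hH h ?_ ?_
      · intro x
        simp only [mem_inter, mem_sdiff, mem_erase, mem_singleton]
        tauto
      · by_contra! hag
        have hgT : ({g} : Finset ι) ⊆ T := singleton_subset_iff.2 (hHT hg)
        have hge : H.erase g ⊆ T \ {g} := by
          rw [sdiff_singleton_eq_erase]
          exact erase_subset_erase g hHT
        rcases key {g} hgT (by simpa using hag) (hgρ.trans (cost_mono ha hge)) with h' | h'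
        · exact absurd h'.2.2 (by simp)
        · have h1 := hH.1
          have h2 := h.1
          have h3 := h'.1
          rw [Finset.sdiff_sdiff_eq_self hsub, cost_sdiff hsub, cost_erase hg] at h2
          rw [Finset.sdiff_sdiff_eq_self hgT, cost_sdiff hgT, cost_singleton] at h3
          rw [cost_sdiff hHT] at h1
          linarith [cost_nonneg hb T]
  · push Not at hmov
    have hle : ∀ g ∈ H, ∀ g' ∈ H, g ≠ g' → a g < ρ := fun g hg g' hg' hgg =>
      (le_cost ha (mem_erase.2 ⟨hgg, hg⟩)).trans_lt (hmov g' hg')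
    have hsmall : ∀ g ∈ H, a g < ρ := by
      intro g hg
      by_cases hgg : g = g₁
      · exact hle g hg g₂ hg₂ (by rwa [hgg])
      · exact hle g hg g₁ hg₁ hgg
    have hHlt : cost a H < 2 * ρ := by
      have h1 := hmov g₁ hg₁
      have h2 := hsmall g₁ hg₁
      rw [cost_erase hg₁] at h1
      linarith
    have hpart : ∀ C : Finset ι, 3 * ρ ≤ cost a C → ρ ≤ cost a (C \ H) := by
      intro C hC
      have h1 := cost_mono ha (show C ⊆ (C \ H) ∪ H by
        intro x hx
        simp [hx])
      linarith [cost_union_le ha (C \ H) H]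
    have hLA := hpart A hA
    have hLB := hpart B hB
    -- a smallest part `N` of `H` that is still heavy together with `B \ H`
    obtain ⟨N, hNmem, hNmin⟩ := exists_min_image
      (H.powerset.filter fun N => heavy (N ∪ B \ H)) card (by
        have hsub : H ∪ B \ H ⊆ T :=
          union_subset hHT (sdiff_subset.trans subset_union_right)
        refine ⟨H, mem_filter.2 ⟨mem_powerset_self H, ?_⟩⟩
        refine (key _ hsub (hHa.trans (cost_mono ha subset_union_left))
          (hLA.trans (cost_mono ha ?_))).resolve_right fun h => ?_
        · intro x
          have : x ∈ A → x ∉ B := fun h => Finset.disjoint_left.1 hAB h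
          simp only [hT, mem_sdiff, mem_union]
          tauto
        · refine not_both _ _ hHT sdiff_subset hH h ?_
          exact disjoint_sdiff.mono_left subset_union_left)
    simp only [mem_filter, mem_powerset] at hNmem hNmin
    obtain ⟨hNH, hN⟩ := hNmem
    have hsubT : ∀ N ⊆ H, N ∪ B \ H ⊆ T := fun N hN =>
      union_subset (hN.trans hHT) (sdiff_subset.trans subset_union_right)
    obtain rfl | ⟨g, hg⟩ := N.eq_empty_or_nonempty
    · refine not_both _ _ (hsubT _ (empty_subset H)) hHT hN hH ?_
      rw [empty_union]
      exact sdiff_disjoint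
    · have hsub := hsubT _ ((erase_subset g N).trans hNH)
      rcases key _ hsub (hLB.trans (cost_mono ha subset_union_right))
        (hLA.trans (cost_mono ha (by
          intro x
          have : x ∈ A → x ∉ B := fun h => Finset.disjoint_left.1 hAB h
          have := @hNH x
          simp only [hT, mem_sdiff, mem_union, mem_erase]
          tauto))) with h | h
      · have := hNmin _ ⟨(erase_subset g N).trans hNH, h⟩
        have := card_erase_lt_of_mem hg
        omega
      · refine pivot _ _ g (hHT (hNH hg)) (hsubT _ hNH) sdiff_subset hN h ?_ (hsmall g (hNH hg))
        intro x
        simp only [mem_inter, mem_sdiff, mem_union, mem_erase, mem_singleton]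
        tauto


/-- Cut and choose. -/
lemma exists_division {b c : ι → ℝ} (hb : ∀ x, 0 ≤ b x) (hc : ∀ x, 0 ≤ c x) (T : Finset ι) :
    ∃ Y Z, Disjoint Y Z ∧ Y ∪ Z = T ∧ Content b Y Z ∧ Content c Z Y := by
  rcases exists_division_or_dominating (a := fun _ => 0) (ρ := 0) (fun _ => le_rfl) hb hc
    (disjoint_empty_right T) (by simp [cost]) (by simp [cost]) with
    ⟨Y, Z, h1, h2, h3, h4, -⟩ | ⟨f, -, h, -⟩
  · exact ⟨Y, Z, h1, by simpa using h2, h3, h4⟩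
  · exact absurd h (lt_irrefl _)

section Allocations

variable {a b c : ι → ℝ}

/-- If `b` and `c` agree on a large chore, then `a` takes it alone and `b`, `c` cut and choose. -/
lemma hasEFX_of_dominating (ha : ∀ x, 0 ≤ a x) (hb : ∀ x, 0 ≤ b x) (hc : ∀ x, 0 ≤ c x)
    {M : Finset ι} {f : ι} (hf : f ∈ M) (hbf : cost b (M.erase f) ≤ 5 * b f)
    (hcf : cost c (M.erase f) ≤ 5 * c f) : HasEFX a b c M := by
  obtain ⟨Y, Z, h1, h2, h3, h4⟩ := exists_division hb hc (M.erase f)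
  have hY : Y ⊆ M.erase f := h2 ▸ subset_union_left
  have hZ : Z ⊆ M.erase f := h2 ▸ subset_union_right
  refine ⟨{f}, Y, Z, ⟨?_, ?_, h1, ?_⟩, content_singleton ha, content_singleton ha,
    content_of_le hb ?_, h3, content_of_le hc ?_, h4⟩
  · exact disjoint_singleton_left.2 fun h => notMem_erase f M (hY h)
  · exact disjoint_singleton_left.2 fun h => notMem_erase f M (hZ h)
  · rw [union_assoc, h2, ← insert_eq, insert_erase hf]
  · rw [cost_singleton]
    exact (cost_mono hb hY).trans hbf
  · rw [cost_singleton]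
    exact (cost_mono hc hZ).trans hcf

/-- If two chores are each large for `b`, compared with all the others, then `a` and `c` take
them alone. -/
lemma hasEFX_of_two_large (ha : ∀ x, 0 ≤ a x) (hb : ∀ x, 0 ≤ b x) (hc : ∀ x, 0 ≤ c x)
    {M : Finset ι} {f g : ι} (hf : f ∈ M) (hg : g ∈ M) (hfg : f ≠ g)
    (hbf : cost b (M \ {f, g}) ≤ 5 * b f) (hbg : cost b (M \ {f, g}) ≤ 5 * b g) :
    HasEFX a b c M := by
  refine ⟨{f}, M \ {f, g}, {g}, ⟨?_, ?_, ?_, ?_⟩, content_singleton ha, content_singleton ha,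
    content_of_le hb ?_, content_of_le hb ?_, content_singleton hc, content_singleton hc⟩
  · simp
  · simpa using hfg
  · simp
  · ext x
    simp only [mem_union, mem_singleton, mem_sdiff, mem_insert]
    grind
  · rwa [cost_singleton]
  · rwa [cost_singleton]

/-- Suppose `a` accepts `G` against both `A` and `B`, and every chore of `K ⊆ G` is worse for `b`
and `c` than everything outside `K`. -/
lemma hasEFX_of_large_chores (ha : ∀ x, 0 ≤ a x) (hb : ∀ x, 0 ≤ b x) (hc : ∀ x, 0 ≤ c x)
    {A B G : Finset ι} (hAB : Disjoint A B) (hAG : Disjoint A G) (hBG : Disjoint B G)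
    (haA : Content a G A) (haB : Content a G B) (K : Finset ι) (hKG : K ⊆ G) (hK : 2 ≤ #K)
    (hbK : ∀ k ∈ K, cost b ((A ∪ B ∪ G) \ K) ≤ b k)
    (hcK : ∀ k ∈ K, cost c ((A ∪ B ∪ G) \ K) ≤ c k) : HasEFX a b c (A ∪ B ∪ G) := by
  induction hn : #K generalizing K with
  | zero => omega
  | succ n ih =>
  have hKM : K ⊆ A ∪ B ∪ G := hKG.trans subset_union_right
  have hGA : ∀ x ∈ G, x ∉ A := fun x hx h => Finset.disjoint_left.1 hAG h hx
  have hGB : ∀ x ∈ G, x ∉ B := fun x hx h => Finset.disjoint_left.1 hBG h hx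
  have hAB' : ∀ x ∈ A, x ∉ B := fun x hx h => Finset.disjoint_left.1 hAB hx h
  obtain hK2 | hK3 := hK.eq_or_lt
  · obtain ⟨k, l, hkl, rfl⟩ := card_eq_two.1 hK2.symm
    exact hasEFX_of_two_large ha hb hc (hKM (by simp)) (hKM (by simp)) hkl
      (by linarith [hbK k (by simp), hb k]) (by linarith [hbK l (by simp), hb l])
  have hAK : A ⊆ (A ∪ B ∪ G) \ K := by
    intro x hx
    have : x ∉ K := fun h => hGA x (hKG h) hx
    simp [hx, this]
  have hBK : B ⊆ (A ∪ B ∪ G) \ K := by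
    intro x hx
    have : x ∉ K := fun h => hGB x (hKG h) hx
    simp [hx, this]
  have give : ∀ y ∈ K, ∀ z ∈ K, y ≠ z → (∀ t ∈ K, b y ≤ 4 * b t) → (∀ t ∈ K, c z ≤ 4 * c t) →
      HasEFX a b c (A ∪ B ∪ G) := by
    intro y hy z hz hyz hby hcz
    obtain ⟨t, ht⟩ : ((K.erase y).erase z).Nonempty := by
      rw [← card_pos, card_erase_of_mem (mem_erase.2 ⟨hyz.symm, hz⟩), card_erase_of_mem hy]
      omega
    have htK : t ∈ K := mem_of_mem_erase (mem_of_mem_erase ht)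
    have htX : t ∈ G \ {y, z} := by
      simp only [mem_erase] at ht
      simp [hKG htK, ht.1, ht.2.1]
    have bound : ∀ f : ι → ℝ, (∀ x, 0 ≤ f x) → (∀ k ∈ K, cost f ((A ∪ B ∪ G) \ K) ≤ f k) →
        ∀ C ⊆ (A ∪ B ∪ G) \ K, ∀ w, (∀ s ∈ K, f w ≤ 4 * f s) → ∀ s ∈ K, ∀ S, s ∈ S →
        Content f (insert w C) S := by
      intro f hf hfK C hC w hw s hs S hsS
      apply content_of_le hf
      linarith [cost_insert_le hf w C, hw s hs, hfK s hs, cost_mono hf hC, le_cost hf hsS]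
    refine ⟨G \ {y, z}, insert y A, insert z B, ⟨?_, ?_, ?_, ?_⟩,
      haA.mono ha sdiff_subset (subset_insert y A), haB.mono ha sdiff_subset (subset_insert z B),
      bound b hb hbK A hAK y hby t htK _ htX, bound b hb hbK A hAK y hby z hz _ (by simp),
      bound c hc hcK B hBK z hcz t htK _ htX, bound c hc hcK B hBK z hcz y hy _ (by simp)⟩
    · rw [Finset.disjoint_left]
      grind
    · rw [Finset.disjoint_left]
      grind
    · rw [Finset.disjoint_left]
      grind
    · grind
  have hKne : K.Nonempty := card_pos.1 (by omega)
  obtain ⟨k, hk, hkmin⟩ := exists_min_image K b hKne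
  obtain ⟨l, hl, hlmin⟩ := exists_min_image K c hKne
  have hkb : ∀ t ∈ K, b k ≤ 4 * b t := fun t ht => by linarith [hkmin t ht, hb t]
  have hlc : ∀ t ∈ K, c l ≤ 4 * c t := fun t ht => by linarith [hlmin t ht, hc t]
  obtain rfl | hkl := eq_or_ne k l
  swap
  · exact give k hk l hl hkl hkb hlc
  have hrest : ∀ f : ι → ℝ, (∀ x, 0 ≤ f x) →
      cost f ((A ∪ B ∪ G) \ K.erase k) ≤ f k + cost f ((A ∪ B ∪ G) \ K) := by
    intro f hf
    refine (cost_mono hf ?_).trans (cost_insert_le hf k _)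
    intro x
    simp only [mem_sdiff, mem_erase, mem_insert]
    tauto
  by_cases hb2 : ∃ t ∈ K.erase k, b t < b k + cost b ((A ∪ B ∪ G) \ K)
  · obtain ⟨t, ht, hlt⟩ := hb2
    refine give t (mem_of_mem_erase ht) k hk (ne_of_mem_erase ht) (fun s hs => ?_) hlc
    linarith [hkmin s hs, hbK k hk, hb s]
  by_cases hc2 : ∃ t ∈ K.erase k, c t < c k + cost c ((A ∪ B ∪ G) \ K)
  · obtain ⟨t, ht, hlt⟩ := hc2
    refine give k hk t (mem_of_mem_erase ht) (ne_of_mem_erase ht).symm hkb (fun s hs => ?_)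
    linarith [hlmin s hs, hcK k hk, hc s]
  push Not at hb2 hc2
  have hcard := card_erase_of_mem hk
  exact ih (K.erase k) ((erase_subset k K).trans hKG) (by omega)
    (fun t ht => (hrest b hb).trans (hb2 t ht)) (fun t ht => (hrest c hc).trans (hc2 t ht))
    (by omega)

/-- Numerical case analysis for an agent who faces the roles `F`, `x` and `y`, each with an
extra `F / 4` attached. -/
lemma acceptable_roles {x y F : ℝ} (hF : 0 < F) (hxy : F ≤ 5 * (x + y)) :
    let α := F + F / 4 ≤ 5 * x ∧ F + F / 4 ≤ 5 * y
    let β := x + F / 4 ≤ 5 * F ∧ x + F / 4 ≤ 5 * y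
    let γ := y + F / 4 ≤ 5 * F ∧ y + F / 4 ≤ 5 * x
    (α ∨ β ∨ γ) ∧ (β ∨ γ ∨ 19 * F < 4 * x ∧ 19 * F < 4 * y) ∧ (α ∨ γ ∨ 4 * x < F) ∧
      (α ∨ β ∨ 4 * y < F) := by
  dsimp only
  refine ⟨?_, ?_, ?_, ?_⟩
  all_goals
    by_contra! h
    grind

/-- The exceptional case in which `b` and `c` agree on a large chore `f`. -/
lemma hasEFX_of_exceptional (ha : ∀ x, 0 ≤ a x) (hb : ∀ x, 0 ≤ b x) (hc : ∀ x, 0 ≤ c x)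
    {A B P : Finset ι} {f : ι} (hAB : Disjoint A B) (hAP : Disjoint A P) (hBP : Disjoint B P)
    (hfA : f ∉ A) (hfB : f ∉ B) (hfP : f ∉ P)
    (haA : Content a (insert f P) A) (haB : Content a (insert f P) B)
    (hbf : 0 < b f) (hcf : 0 < c f)
    (hbA : 4 * cost b A ≤ b f) (hbB : 4 * cost b B ≤ b f) (hbP : b f ≤ 5 * cost b P)
    (hcA : 4 * cost c A ≤ c f) (hcB : 4 * cost c B ≤ c f) (hcP : c f ≤ 5 * cost c P) :
    HasEFX a b c (A ∪ B ∪ insert f P) := by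
  have dA : ∀ x ∈ insert f P, x ∉ A := by
    have := Finset.disjoint_left.1 hAP
    grind
  have dB : ∀ x ∈ insert f P, x ∉ B := by
    have := Finset.disjoint_left.1 hBP
    grind
  have dAB : ∀ x ∈ A, x ∉ B := fun x hx => Finset.disjoint_left.1 hAB hx
  by_contra hno
  have perm : ∀ U V W : Finset ι, Disjoint U V → Disjoint U W → Disjoint V W →
      U ∪ V ∪ W = insert f P →
      ¬ ((cost b V + b f / 4 ≤ 5 * cost b U ∧ cost b V + b f / 4 ≤ 5 * cost b W) ∧
        cost c W + c f / 4 ≤ 5 * cost c U ∧ cost c W + c f / 4 ≤ 5 * cost c V) := by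
    rintro U V W hUV hUW hVW hU ⟨⟨h1, h2⟩, h3, h4⟩
    have hUs : U ⊆ insert f P := by grind
    have hb1 := cost_union_le hb V A
    have hc1 := cost_union_le hc W B
    have hb2 := cost_mono hb (show W ⊆ W ∪ B from subset_union_left)
    have hc2 := cost_mono hc (show V ⊆ V ∪ A from subset_union_left)
    rw [Finset.disjoint_left] at hUV hUW hVW
    refine hno ⟨U, V ∪ A, W ∪ B, ⟨?_, ?_, ?_, ?_⟩, haA.mono ha hUs subset_union_right,
      haB.mono ha hUs subset_union_right, content_of_le hb (by linarith),
      content_of_le hb (by linarith), content_of_le hc (by linarith),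
      content_of_le hc (by linarith)⟩
    · rw [Finset.disjoint_left]
      grind
    · rw [Finset.disjoint_left]
      grind
    · rw [Finset.disjoint_left]
      grind
    · grind
  have dich : ∀ X ⊆ P, (4 * cost b X < b f ∧ 4 * cost c X < c f) ∨
      (4 * cost b (P \ X) < b f ∧ 4 * cost c (P \ X) < c f) ∨
      (19 * b f < 4 * cost b X ∧ 19 * c f < 4 * cost c X) := by
    intro X hX
    have e1 := cost_sdiff (f := b) hX
    have e2 := cost_sdiff (f := c) hX
    have d1 : Disjoint {f} X := disjoint_singleton_left.2 fun h => hfP (hX h)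
    have d2 : Disjoint {f} (P \ X) := disjoint_singleton_left.2 fun h => hfP (mem_sdiff.1 h).1
    have d3 : Disjoint X (P \ X) := disjoint_sdiff
    have u : {f} ∪ (X ∪ P \ X) = insert f P := by rw [union_sdiff_of_subset hX, insert_eq]
    have p1 := perm {f} X (P \ X) d1 d2 d3 (by rw [union_assoc, u])
    have p2 := perm {f} (P \ X) X d2 d1 d3.symm (by rw [union_assoc, union_comm (P \ X), u])
    have p3 := perm X {f} (P \ X) d1.symm d3 d2 (by rw [union_comm X, union_assoc, u])
    have p4 := perm X (P \ X) {f} d3 d1.symm d2.symm (by rw [union_comm _ {f}, u])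
    have p5 := perm (P \ X) {f} X d2.symm d3.symm d1
      (by rw [union_comm _ {f}, union_assoc, union_comm _ X, u])
    have p6 := perm (P \ X) X {f} d3.symm d2.symm d1.symm
      (by rw [union_comm _ {f}, union_comm _ X, u])
    simp only [cost_singleton] at p1 p2 p3 p4 p5 p6
    have nb := acceptable_roles (x := cost b X) (y := cost b (P \ X)) hbf (by linarith)
    have nc := acceptable_roles (x := cost c X) (y := cost c (P \ X)) hcf (by linarith)
    obtain ⟨nb0, nb1, nb2, nb3⟩ := nb
    obtain ⟨nc0, nc1, nc2, nc3⟩ := nc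
    rcases nb0 with h | h | h
    · have q1 := fun h' => p3 ⟨h, And.symm h'⟩
      have q2 := fun h' => p5 ⟨h.symm, And.symm h'⟩
      have hα := nc0.resolve_right (not_or.2 ⟨q2, q1⟩)
      have q3 := fun h' => p4 ⟨And.symm h', hα⟩
      have q4 := fun h' => p6 ⟨And.symm h', hα.symm⟩
      exact Or.inr (Or.inr ⟨((nb1.resolve_left q4).resolve_left q3).1,
        ((nc1.resolve_left q2).resolve_left q1).1⟩)
    · have q1 := fun h' => p1 ⟨h, h'⟩
      have q2 := fun h' => p6 ⟨h.symm, And.symm h'⟩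
      have hβ := (nc0.resolve_left q2).resolve_right q1
      have q3 := fun h' => p2 ⟨h', hβ⟩
      have q4 := fun h' => p5 ⟨And.symm h', hβ.symm⟩
      exact Or.inl ⟨(nb2.resolve_left q4).resolve_left q3, (nc2.resolve_left q2).resolve_left q1⟩
    · have q1 := fun h' => p2 ⟨h, h'⟩
      have q2 := fun h' => p4 ⟨h.symm, h'⟩
      have hγ := (nc0.resolve_left q2).resolve_left q1
      have q3 := fun h' => p1 ⟨h', hγ⟩
      have q4 := fun h' => p3 ⟨h', hγ.symm⟩
      exact Or.inr (Or.inl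
        ⟨(nb3.resolve_left q4).resolve_left q3, (nc3.resolve_left q2).resolve_left q1⟩)
  -- a largest part of `P` that is small for both agents
  obtain ⟨Q, hQmem, hQmax⟩ := exists_max_image
    (P.powerset.filter fun Q => 4 * cost b Q < b f ∧ 4 * cost c Q < c f) card
    ⟨∅, by simp [hbf, hcf]⟩
  simp only [mem_filter, mem_powerset] at hQmem hQmax
  obtain ⟨hQP, hQb, hQc⟩ := hQmem
  have rest : ∀ g : ι → ℝ, (∀ x, 0 ≤ g x) → ∀ K R : Finset ι, f ∈ K → P \ K ⊆ R →
      cost g ((A ∪ B ∪ insert f P) \ K) ≤ cost g A + cost g B + cost g R := by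
    intro g hg K R hf hR
    have hsub : (A ∪ B ∪ insert f P) \ K ⊆ A ∪ B ∪ R := by
      intro x hx
      have := @hR x
      simp only [mem_sdiff, mem_union, mem_insert] at hx this ⊢
      have : x = f → x ∈ K := fun h => h ▸ hf
      tauto
    linarith [cost_mono hg hsub, cost_union_le hg (A ∪ B) R, cost_union_le hg A B]
  have hfM : f ∈ A ∪ B ∪ insert f P := by simp
  by_cases hbig : ∀ x ∈ P \ Q, 19 * b f < 4 * (b x + cost b Q) ∧ 19 * c f < 4 * (c x + cost c Q)
  · obtain hPQ | ⟨x, hx⟩ := (P \ Q).eq_empty_or_nonempty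
    · have hPQ' : P \ {f} ⊆ Q := sdiff_subset.trans (sdiff_eq_empty_iff_subset.1 hPQ)
      refine hno (hasEFX_of_dominating ha hb hc hfM ?_ ?_) <;> rw [← sdiff_singleton_eq_erase]
      · linarith [rest b hb {f} Q (by simp) hPQ']
      · linarith [rest c hc {f} Q (by simp) hPQ']
    · have hfPQ : f ∉ P \ Q := fun h => hfP (mem_sdiff.1 h).1
      have hrest : P \ insert f (P \ Q) ⊆ Q := by
        intro x
        simp only [mem_sdiff, mem_insert]
        tauto
      refine hno (hasEFX_of_large_chores ha hb hc hAB (disjoint_insert_right.2 ⟨hfA, hAP⟩)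
        (disjoint_insert_right.2 ⟨hfB, hBP⟩) haA haB (insert f (P \ Q))
        (insert_subset_insert f sdiff_subset) ?_ ?_ ?_)
      · rw [card_insert_of_notMem hfPQ]
        have := card_pos.2 ⟨x, hx⟩
        omega
      · intro k hk
        have := rest b hb _ Q (mem_insert_self f _) hrest
        obtain rfl | hk := mem_insert.1 hk
        · linarith
        · linarith [(hbig k hk).1]
      · intro k hk
        have := rest c hc _ Q (mem_insert_self f _) hrest
        obtain rfl | hk := mem_insert.1 hk
        · linarith
        · linarith [(hbig k hk).2]
  · push Not at hbig
    obtain ⟨x, hx, hxb⟩ := hbig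
    obtain ⟨hxP, hxQ⟩ := mem_sdiff.1 hx
    have hfx : f ≠ x := fun h => hfP (h ▸ hxP)
    have hQx : insert x Q ⊆ P := insert_subset hxP hQP
    rcases dich _ hQx with h | h | h
    · have h1 := hQmax _ ⟨hQx, h⟩
      rw [card_insert_of_notMem hxQ] at h1
      omega
    · set N := P \ insert x Q
      have hsub : P \ {f, x} ⊆ Q ∪ N := by
        intro y
        simp only [N, mem_sdiff, mem_union, mem_insert, mem_singleton]
        tauto
      have hsub' : P \ {f} ⊆ insert x (Q ∪ N) := by
        intro y
        simp only [N, mem_sdiff, mem_union, mem_insert, mem_singleton]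
        tauto
      have hxM : x ∈ A ∪ B ∪ insert f P := by simp [hxP]
      have rb := rest b hb _ _ (by simp) hsub
      have rc := rest c hc _ _ (by simp) hsub
      have ub := cost_union_le hb Q N
      have uc := cost_union_le hc Q N
      by_cases hbx : b f ≤ 5 * b x
      · exact hno (hasEFX_of_two_large ha hb hc hfM hxM hfx (by linarith) (by linarith))
      by_cases hcx : c f ≤ 5 * c x
      · exact hno (hasEFX_of_two_large ha hc hb hfM hxM hfx (by linarith) (by linarith)).swap
      have rb' := rest b hb _ _ (by simp) hsub'
      have rc' := rest c hc _ _ (by simp) hsub'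
      refine hno (hasEFX_of_dominating ha hb hc hfM ?_ ?_) <;> rw [← sdiff_singleton_eq_erase]
      · linarith [cost_insert_le hb x (Q ∪ N)]
      · linarith [cost_insert_le hc x (Q ∪ N)]
    · rw [cost_insert hxQ, cost_insert hxQ] at h
      exact absurd h.2 (not_lt.2 (hxb h.1))

/-- The bundle `Q` can go to `a`, up to exceptions, when the other agents find it to cost at least
a fifth of the rest. -/
lemma hasEFX_of_acceptable_bundle (ha : ∀ x, 0 ≤ a x) (hb : ∀ x, 0 ≤ b x) (hc : ∀ x, 0 ≤ c x)
    {P Q R : Finset ι} (hPQ : Disjoint P Q) (hPR : Disjoint P R) (hQR : Disjoint Q R)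
    (haP : ∀ e ∈ Q, cost a (Q.erase e) ≤ cost a P) (haR : ∀ e ∈ Q, cost a (Q.erase e) ≤ cost a R)
    (hQ : Q.Nontrivial)
    (hbQ : cost b P + cost b R ≤ 5 * cost b Q) (hcQ : cost c P + cost c R ≤ 5 * cost c Q)
    (hbP : 5 * cost b P ≤ cost b R) (hcP : 5 * cost c P ≤ cost c R) :
    HasEFX a b c (P ∪ Q ∪ R) := by
  obtain ⟨e₀, he₀, hmin⟩ := exists_min_image Q a hQ.nonempty
  set u := cost a (Q.erase e₀) with hu
  have hu0 : 0 ≤ u := cost_nonneg ha _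
  have hQu : ∀ e ∈ Q, cost a (Q.erase e) ≤ u := by
    intro e he
    rw [hu, cost_erase he, cost_erase he₀]
    linarith [hmin e he]
  have hQ2 : cost a Q ≤ 2 * u := by
    obtain ⟨e₁, he₁, hne⟩ := hQ.exists_ne e₀
    have h1 := hmin e₁ he₁
    have h2 : a e₁ ≤ u := le_cost ha (mem_erase.2 ⟨hne, he₁⟩)
    rw [cost_erase he₀] at hu
    linarith
  have huP := haP e₀ he₀
  have huR := haR e₀ he₀
  have hcontent : ∀ S, u ≤ 5 * cost a S → Content a Q S := fun S hS e he => (hQu e he).trans hS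
  rcases exists_division_or_dominating ha hb hc hPR (ρ := u / 5) (by linarith) (by linarith) with
    ⟨Y, Z, hYZ, hU, hbYZ, hcZY, haY, haZ⟩ | ⟨f, hf, haf, hbf, hcf⟩
  · have hY : Y ⊆ P ∪ R := hU ▸ subset_union_left
    have hZ : Z ⊆ P ∪ R := hU ▸ subset_union_right
    have hQPR : Disjoint Q (P ∪ R) := disjoint_union_right.2 ⟨hPQ.symm, hQR⟩
    refine ⟨Q, Y, Z, ⟨hQPR.mono_right hY, hQPR.mono_right hZ, hYZ, ?_⟩,
      hcontent Y (by linarith), hcontent Z (by linarith), content_of_le hb ?_, hbYZ,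
      content_of_le hc ?_, hcZY⟩
    · rw [union_assoc, hU, union_left_comm, union_assoc]
    · linarith [cost_mono hb hY, cost_union_le hb P R]
    · linarith [cost_mono hc hZ, cost_union_le hc P R]
  · have hfP : f ∉ P := by
      intro h
      have h1 := le_cost hb h
      rw [cost_erase hf, cost_union hPR] at hbf
      linarith [cost_nonneg hb P]
    have hfR : f ∈ R := (mem_union.1 hf).resolve_left hfP
    have hfQ : f ∉ Q := fun h => Finset.disjoint_left.1 hQR h hfR
    rw [cost_erase hf, cost_union hPR] at hbf hcf
    set D := R.erase f with hD
    have hfD : f ∉ D := notMem_erase f R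
    have hDR : insert f D = R := insert_erase hfR
    have hRa : cost a R = a f + cost a D := by rw [← hDR, cost_insert hfD]
    have hRb : cost b R = b f + cost b D := by rw [← hDR, cost_insert hfD]
    have hRc : cost c R = c f + cost c D := by rw [← hDR, cost_insert hfD]
    have hPD : Disjoint P D := hPR.mono_right (erase_subset f R)
    have hQD : Disjoint Q D := hQR.mono_right (erase_subset f R)
    have split : ∀ g h : ι → ℝ, (∀ x, 0 ≤ g x) → (∀ x, 0 ≤ h x) →
        cost g R = g f + cost g D → cost h R = h f + cost h D →
        cost g P + cost g R ≤ 5 * cost g Q → cost h P + cost h R ≤ 5 * cost h Q →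
        2 * (cost h P + cost h R - h f) < h f → Content g (insert f P) D →
        HasEFX a g h (P ∪ Q ∪ R) := by
      intro g h hg hh h1 h2 h3 h4 h5 h6
      have h7 := le_cost hh (mem_insert_self f P)
      have h8 := cost_nonneg hh P
      have h9 := hh f
      refine ⟨Q, insert f P, D, ⟨disjoint_insert_right.2 ⟨hfQ, hPQ.symm⟩, hQD,
        disjoint_insert_left.2 ⟨hfD, hPD⟩, ?_⟩, hcontent _ ?_, hcontent _ ?_, content_of_le hg ?_,
        h6, content_of_le hh ?_, content_of_le hh ?_⟩
      · rw [← hDR]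
        ext x
        simp only [mem_union, mem_insert]
        tauto
      · linarith [cost_mono ha (subset_insert f P)]
      · linarith
      · linarith [cost_insert_le hg f P, cost_nonneg hg D]
      · linarith
      · linarith
    by_cases hb1 : Content b (insert f P) D
    · exact split b c hb hc hRb hRc hbQ hcQ hcf hb1
    by_cases hc1 : Content c (insert f P) D
    · exact (split c b hc hb hRc hRb hcQ hbQ hbf hc1).swap
    have hb2 := (lt_and_nontrivial_of_not_content hb hb1).1
    have hc2 := (lt_and_nontrivial_of_not_content hc hc1).1
    rw [cost_insert hfP] at hb2 hc2
    have hM : P ∪ Q ∪ R = P ∪ D ∪ insert f Q := by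
      rw [← hDR]
      ext x
      simp only [mem_union, mem_insert]
      tauto
    have hbP0 := cost_nonneg hb P
    have hbD0 := cost_nonneg hb D
    have hcP0 := cost_nonneg hc P
    have hcD0 := cost_nonneg hc D
    have hfQa := cost_insert_le ha f Q
    rw [hM]
    refine hasEFX_of_exceptional ha hb hc hPD hPQ hQD.symm hfP hfD hfQ (content_of_le ha ?_)
      (content_of_le ha ?_) ?_ ?_ ?_ ?_ ?_ ?_ ?_ ?_ <;> linarith

/-- A bundle from which no single chore can be removed too harmfully can be cut in two parts. -/
lemma exists_balanced_subset (hc : ∀ x, 0 ≤ c x) {P : Finset ι} {t : ℝ} (hP : 3 * t ≤ cost c P)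
    (herase : ∀ f ∈ P, t ≤ cost c (P.erase f)) :
    ∃ Y ⊆ P, t ≤ cost c Y ∧ t ≤ cost c (P \ Y) := by
  by_cases hbig : ∃ f ∈ P, t ≤ c f
  · obtain ⟨f, hf, htf⟩ := hbig
    refine ⟨{f}, singleton_subset_iff.2 hf, by rwa [cost_singleton], ?_⟩
    rw [sdiff_singleton_eq_erase]
    exact herase f hf
  push Not at hbig
  have hP0 := cost_nonneg hc P
  obtain ⟨Y, hYmem, hYmin⟩ := exists_min_image (P.powerset.filter fun Y => t ≤ cost c Y) card
    ⟨P, mem_filter.2 ⟨mem_powerset_self P, by by_contra; linarith⟩⟩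
  simp only [mem_filter, mem_powerset] at hYmem hYmin
  obtain ⟨hYP, hY⟩ := hYmem
  refine ⟨Y, hYP, hY, ?_⟩
  obtain rfl | ⟨y, hy⟩ := Y.eq_empty_or_nonempty
  · rw [cost_empty] at hY
    exact hY.trans (cost_nonneg hc _)
  · have h1 : cost c (Y.erase y) < t := by
      by_contra! h
      have := hYmin _ ⟨(erase_subset y Y).trans hYP, h⟩
      have := card_erase_lt_of_mem hy
      omega
    rw [cost_erase hy] at h1
    rw [cost_sdiff hYP]
    linarith [hbig y (hYP hy)]

/-- If `R` is bad for `c` but good for `b`, either it can be split or it has a chore which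
dominates it for `c`. -/
lemma hasEFX_or_exists_dominating (ha : ∀ x, 0 ≤ a x) (hb : ∀ x, 0 ≤ b x) (hc : ∀ x, 0 ≤ c x)
    {P Q R : Finset ι} (hPQ : Disjoint P Q) (hPR : Disjoint P R) (hQR : Disjoint Q R)
    (haP : Content a R P) (haQ : Content a R Q)
    (hbR : 5 * cost b R ≤ cost b P + cost b Q) (hbP : 5 * cost b P ≤ cost b R)
    (hcQ : 5 * cost c Q ≤ cost c P + cost c R) (hcP : 5 * cost c P ≤ cost c Q) :
    HasEFX a b c (P ∪ Q ∪ R) ∨ ∃ f ∈ R, 5 * cost c (R.erase f) < cost c Q := by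
  by_contra! hcon
  obtain ⟨hno, herase⟩ := hcon
  have hb0 := cost_nonneg hb R
  have hc0 := cost_nonneg hc Q
  have uneven : ∀ Y ⊆ R, cost c Q / 5 ≤ cost c Y → cost c Q / 5 ≤ cost c (R \ Y) →
      ¬ cost b Y ≤ cost b (R \ Y) := by
    intro Y hY h1 h2 h3
    have hRb := cost_sdiff (f := b) hY
    have h4 := cost_union_le hb P Y
    have h5 := cost_mono hc (show Y ⊆ P ∪ Y from subset_union_right)
    have hYR : Disjoint (R \ Y) Y := sdiff_disjoint
    refine hno ⟨R \ Y, P ∪ Y, Q, ⟨?_, ?_, ?_, ?_⟩, haP.mono ha sdiff_subset subset_union_left,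
      haQ.mono ha sdiff_subset le_rfl, content_of_le hb (by linarith),
      content_of_le hb (by linarith), content_of_le hc (by linarith),
      content_of_le hc (by linarith)⟩
    · exact disjoint_union_right.2 ⟨hPR.symm.mono_left sdiff_subset, hYR⟩
    · exact hQR.symm.mono_left sdiff_subset
    · exact disjoint_union_left.2 ⟨hPQ, hQR.symm.mono_left hY⟩
    · ext x
      have := @hY x
      simp only [mem_union, mem_sdiff]
      tauto
  obtain ⟨Y, hY, h1, h2⟩ := exists_balanced_subset hc (P := R) (t := cost c Q / 5)
    (by linarith) fun f hf => by linarith [herase f hf]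
  have hRY : R \ (R \ Y) = Y := Finset.sdiff_sdiff_eq_self hY
  have h3 := uneven Y hY h1 h2
  have h4 := uneven (R \ Y) sdiff_subset h2 (by rwa [hRY])
  rw [hRY] at h4
  exact h4 (le_of_not_ge h3)

/-- A chore of `Q` that is large for `a` and `b` goes to `c`. -/
lemma hasEFX_of_large_chore (ha : ∀ x, 0 ≤ a x) (hb : ∀ x, 0 ≤ b x) (hc : ∀ x, 0 ≤ c x)
    {P Q R : Finset ι} {f : ι} (hPQ : Disjoint P Q) (hPR : Disjoint P R) (hQR : Disjoint Q R)
    (hf : f ∈ Q) (haP : Content a R P) (haQ : ∀ e ∈ R, cost a (R.erase e) ≤ cost a Q)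
    (haf : cost a (Q.erase f) ≤ 4 * a f) (hbR : cost b P + cost b (Q.erase f) ≤ 5 * cost b R)
    (hbf : cost b P + cost b (Q.erase f) ≤ 5 * b f) : HasEFX a b c (P ∪ Q ∪ R) := by
  have hun := cost_union_le hb P (Q.erase f)
  have hfP : f ∉ P := fun h => Finset.disjoint_left.1 hPQ h hf
  have hfR : f ∉ R := fun h => Finset.disjoint_left.1 hQR hf h
  refine ⟨R, P ∪ Q.erase f, {f}, ⟨?_, ?_, ?_, ?_⟩, haP.mono ha le_rfl subset_union_left, ?_,
    content_of_le hb (by linarith), content_of_le hb (by rw [cost_singleton]; linarith),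
    content_singleton hc, content_singleton hc⟩
  · exact disjoint_union_right.2 ⟨hPR.symm, hQR.symm.mono_right (erase_subset f Q)⟩
  · exact disjoint_singleton_right.2 hfR
  · exact disjoint_singleton_right.2 (by simp [hfP])
  · nth_rewrite 2 [← insert_erase hf]
    ext x
    simp only [mem_union, mem_insert, mem_singleton]
    tauto
  · intro e he
    have := haQ e he
    rw [cost_erase hf] at haf
    rw [cost_singleton]
    linarith

/-- The agents `b` and `c` prefer different bundles among `Q` and `R`, after `P`. -/
lemma hasEFX_of_opposed (ha : ∀ x, 0 ≤ a x) (hb : ∀ x, 0 ≤ b x) (hc : ∀ x, 0 ≤ c x)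
    {P Q R : Finset ι} (hPQ : Disjoint P Q) (hPR : Disjoint P R) (hQR : Disjoint Q R)
    (haQP : ∀ e ∈ Q, cost a (Q.erase e) ≤ cost a P) (haQR : ∀ e ∈ Q, cost a (Q.erase e) ≤ cost a R)
    (haRP : ∀ e ∈ R, cost a (R.erase e) ≤ cost a P) (haRQ : ∀ e ∈ R, cost a (R.erase e) ≤ cost a Q)
    (hbR : 5 * cost b R ≤ cost b P + cost b Q) (hbP : 5 * cost b P ≤ cost b R)
    (hcQ : 5 * cost c Q ≤ cost c P + cost c R) (hcP : 5 * cost c P ≤ cost c Q) :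
    HasEFX a b c (P ∪ Q ∪ R) := by
  have content : ∀ {S T : Finset ι}, (∀ e ∈ S, cost a (S.erase e) ≤ cost a T) →
      Content a S T := fun {S T} h e he => by linarith [h e he, cost_nonneg ha T]
  have hM : P ∪ R ∪ Q = P ∪ Q ∪ R := union_right_comm P R Q
  by_contra hno
  obtain ⟨k, hk, hck⟩ := (hasEFX_or_exists_dominating ha hb hc hPQ hPR hQR (content haRP)
    (content haRQ) hbR hbP hcQ hcP).resolve_left hno
  obtain ⟨l, hl, hbl⟩ := (hasEFX_or_exists_dominating ha hc hb hPR hPQ hQR.symm (content haQP)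
    (content haQR) hcQ hcP hbR hbP).resolve_left fun h => hno (hM ▸ h.swap)
  have hbQl := cost_erase (f := b) hl
  have hcQl := cost_erase (f := c) hl
  have hbRk := cost_erase (f := b) hk
  have hcRk := cost_erase (f := c) hk
  have hb0 := cost_nonneg hb P
  have hc0 := cost_nonneg hc P
  have hlk : l ≠ k := fun h => Finset.disjoint_left.1 hQR hl (h ▸ hk)
  have hal : 4 * a l < cost a (Q.erase l) := by
    by_contra! h
    exact hno (hasEFX_of_large_chore ha hb hc hPQ hPR hQR hl (content haRP) haRQ h (by linarith)
      (by linarith))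
  have hak : 4 * a k < cost a (R.erase k) := by
    by_contra! h
    exact hno (hM ▸ (hasEFX_of_large_chore ha hc hb hPR hPQ hQR.symm hk (content haQP) haQR h
      (by linarith) (by linarith)).swap)
  set D := Q.erase l with hD
  set E := R.erase k with hE
  have hQD : insert l D = Q := insert_erase hl
  have hRE : insert k E = R := insert_erase hk
  have hlM : l ∈ P ∪ Q ∪ R := by simp [hl]
  have hkM : k ∈ P ∪ Q ∪ R := by simp [hk]
  have rest : ∀ g : ι → ℝ, (∀ x, 0 ≤ g x) →
      cost g ((P ∪ Q ∪ R) \ {l, k}) ≤ cost g P + cost g D + cost g E := by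
    intro g hg
    have hsub : (P ∪ Q ∪ R) \ {l, k} ⊆ P ∪ D ∪ E := by
      intro x
      simp only [D, E, mem_union, mem_sdiff, mem_erase, mem_insert, mem_singleton]
      tauto
    linarith [cost_mono hg hsub, cost_union_le hg (P ∪ D) E, cost_union_le hg P D]
  have hcD : 2 * c l < cost c D := by
    by_contra! h
    have := rest c hc
    exact hno (hasEFX_of_two_large ha hc hb hlM hkM hlk (by linarith) (by linarith)).swap
  have hbE : 2 * b k < cost b E := by
    by_contra! h
    have := rest b hb
    exact hno (hasEFX_of_two_large ha hb hc hlM hkM hlk (by linarith) (by linarith))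
  have hDQ : D ⊆ Q := erase_subset l Q
  have hER : E ⊆ R := erase_subset k R
  have hDE : Disjoint D E := (hQR.mono_left hDQ).mono_right hER
  have hP : Disjoint P (D ∪ E) :=
    disjoint_union_right.2 ⟨hPQ.mono_right hDQ, hPR.mono_right hER⟩
  have haD := cost_mono ha (show D ⊆ D ∪ E from subset_union_left)
  have haE := cost_mono ha (show E ⊆ D ∪ E from subset_union_right)
  have hal0 := ha l
  have hak0 := ha k
  have haDP := haQP l hl
  have haEP := haRP k hk
  have hsum : ∀ g : ι → ℝ, cost g (P ∪ (D ∪ E)) = cost g P + (cost g D + cost g E) := fun g => by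
    rw [cost_union hP, cost_union hDE]
  rcases exists_division_or_dominating ha hb hc hP (ρ := max (a l) (a k) / 5)
    (by rcases max_cases (a l) (a k) with ⟨h, -⟩ | ⟨h, -⟩ <;> rw [h] <;> linarith)
    (by rcases max_cases (a l) (a k) with ⟨h, -⟩ | ⟨h, -⟩ <;> rw [h] <;> linarith) with
    ⟨Y, Z, hYZ, hU, hbYZ, hcZY, haY, haZ⟩ | ⟨f, hf, -, hbf, hcf⟩
  · have hlU : ∀ x ∈ P ∪ (D ∪ E), x ≠ l ∧ x ≠ k := by
      intro x hx
      have h1 : x ∈ P → x ∉ Q := fun h => Finset.disjoint_left.1 hPQ h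
      have h2 : x ∈ P → x ∉ R := fun h => Finset.disjoint_left.1 hPR h
      have h3 : x ∈ Q → x ∉ R := fun h => Finset.disjoint_left.1 hQR h
      constructor <;> rintro rfl <;>
        simp only [D, E, mem_union, mem_erase, ne_eq, not_true_eq_false, false_and] at hx <;> tauto
    have hY : Y ⊆ P ∪ (D ∪ E) := hU ▸ subset_union_left
    have hZ : Z ⊆ P ∪ (D ∪ E) := hU ▸ subset_union_right
    have hcont : ∀ S, max (a l) (a k) / 5 ≤ cost a S → Content a {l, k} S := by
      intro S hS e he
      have h1 := le_max_left (a l) (a k)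
      have h2 := le_max_right (a l) (a k)
      rw [cost_erase he, insert_eq, cost_union (disjoint_singleton.2 hlk), cost_singleton,
        cost_singleton]
      obtain rfl | h := mem_insert.1 he
      · linarith
      · obtain rfl := mem_singleton.1 h
        linarith
    have hbY := cost_mono hb hY
    have hcZ := cost_mono hc hZ
    rw [hsum] at hbY hcZ
    have hbk0 := hb k
    have hcl0 := hc l
    have hbX := le_cost hb (mem_insert_self l {k})
    have hcX := le_cost hc (show k ∈ ({l, k} : Finset ι) by simp)
    refine hno ⟨{l, k}, Y, Z, ⟨?_, ?_, hYZ, ?_⟩, hcont Y haY, hcont Z haZ,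
      content_of_le hb (by linarith), hbYZ, content_of_le hc (by linarith), hcZY⟩
    · rw [disjoint_insert_left, disjoint_singleton_left]
      exact ⟨fun h => (hlU _ (hY h)).1 rfl, fun h => (hlU _ (hY h)).2 rfl⟩
    · rw [disjoint_insert_left, disjoint_singleton_left]
      exact ⟨fun h => (hlU _ (hZ h)).1 rfl, fun h => (hlU _ (hZ h)).2 rfl⟩
    · rw [union_assoc, hU, ← hQD, ← hRE]
      ext x
      simp only [mem_union, mem_insert, mem_singleton]
      tauto
  · rw [cost_erase hf, hsum] at hbf hcf
    have hfD : f ∈ D := by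
      by_contra h
      have hf' : f ∈ P ∪ E := by
        simp only [mem_union] at hf ⊢
        tauto
      linarith [le_cost hc hf', cost_union_le hc P E, hc l, cost_nonneg hc E]
    have hfE : f ∈ E := by
      by_contra h
      have hf' : f ∈ P ∪ D := by
        simp only [mem_union] at hf ⊢
        tauto
      linarith [le_cost hb hf', cost_union_le hb P D, hb k, cost_nonneg hb D]
    exact Finset.disjoint_left.1 hDE hfD hfE

/-- All agents agree that the bundle `P` of an allocation which is fair for `a` is the best. -/
lemma hasEFX_of_common_best (ha : ∀ x, 0 ≤ a x) (hb : ∀ x, 0 ≤ b x) (hc : ∀ x, 0 ≤ c x)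
    {P Q R : Finset ι} (hPQ : Disjoint P Q) (hPR : Disjoint P R) (hQR : Disjoint Q R)
    (haQP : ∀ e ∈ Q, cost a (Q.erase e) ≤ cost a P) (haQR : ∀ e ∈ Q, cost a (Q.erase e) ≤ cost a R)
    (haRP : ∀ e ∈ R, cost a (R.erase e) ≤ cost a P) (haRQ : ∀ e ∈ R, cost a (R.erase e) ≤ cost a Q)
    (hQ : Q.Nontrivial) (hR : R.Nontrivial)
    (hbQ : 5 * cost b P ≤ cost b Q) (hbR : 5 * cost b P ≤ cost b R)
    (hcQ : 5 * cost c P ≤ cost c Q) (hcR : 5 * cost c P ≤ cost c R) :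
    HasEFX a b c (P ∪ Q ∪ R) := by
  have hM : P ∪ R ∪ Q = P ∪ Q ∪ R := union_right_comm P R Q
  have hb0 := cost_nonneg hb P
  have hc0 := cost_nonneg hc P
  by_cases hb1 : cost b P + cost b R ≤ 5 * cost b Q
  · by_cases hc1 : cost c P + cost c R ≤ 5 * cost c Q
    · exact hasEFX_of_acceptable_bundle ha hb hc hPQ hPR hQR haQP haQR hQ hb1 hc1 hbR hcR
    by_cases hb2 : cost b P + cost b Q ≤ 5 * cost b R
    · exact hM ▸ hasEFX_of_acceptable_bundle ha hb hc hPR hPQ hQR.symm haRP haRQ hR hb2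
        (by linarith) hbQ hcQ
    · exact hasEFX_of_opposed ha hb hc hPQ hPR hQR haQP haQR haRP haRQ (by linarith) hbR
        (by linarith) hcQ
  · by_cases hc2 : cost c P + cost c Q ≤ 5 * cost c R
    · exact hM ▸ hasEFX_of_acceptable_bundle ha hb hc hPR hPQ hQR.symm haRP haRQ hR (by linarith)
        hc2 hbQ hcQ
    · exact hM ▸ hasEFX_of_opposed ha hb hc hPR hPQ hQR.symm haRP haRQ haQP haQR (by linarith) hbQ
        (by linarith) hcR

/-- Longest processing time first: an allocation which is fair for identical agents. -/
lemma exists_fair_partition (ha : ∀ x, 0 ≤ a x) (M : Finset ι) :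
    ∃ P : Fin 3 → Finset ι, (∀ i j, i ≠ j → Disjoint (P i) (P j)) ∧ univ.biUnion P = M ∧
      ∀ i j, ∀ e ∈ P i, cost a ((P i).erase e) ≤ cost a (P j) := by
  induction M using Finset.induction_on_min_value a with
  | empty => exact ⟨fun _ => ∅, by simp, by ext; simp, by simp⟩
  | insert x s hx hmin ih =>
    obtain ⟨P, hdisj, hM, hP⟩ := ih
    obtain ⟨k, -, hk⟩ := exists_min_image univ (fun i => cost a (P i)) ⟨0, mem_univ _⟩
    have hsub : ∀ i, P i ⊆ s := fun i => hM ▸ subset_biUnion_of_mem P (mem_univ i)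
    have hxP : ∀ i, x ∉ P i := fun i h => hx (hsub i h)
    have hle : ∀ j, cost a (P j) ≤ cost a (Function.update P k (insert x (P k)) j) := by
      intro j
      obtain rfl | hj := eq_or_ne j k
      · rw [Function.update_self]
        exact cost_mono ha (subset_insert x _)
      · rw [Function.update_of_ne hj]
    refine ⟨Function.update P k (insert x (P k)), ?_, ?_, ?_⟩
    · intro i j hij
      obtain rfl | hi := eq_or_ne i k
      · rw [Function.update_self, Function.update_of_ne hij.symm, disjoint_insert_left]
        exact ⟨hxP j, hdisj _ _ hij⟩
      · obtain rfl | hj := eq_or_ne j k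
        · rw [Function.update_self, Function.update_of_ne hij, disjoint_insert_right]
          exact ⟨hxP i, hdisj _ _ hij⟩
        · rw [Function.update_of_ne hi, Function.update_of_ne hj]
          exact hdisj _ _ hij
    · ext y
      rw [← hM]
      simp only [mem_biUnion, mem_univ, true_and, mem_insert]
      constructor
      · rintro ⟨i, hi⟩
        obtain rfl | hik := eq_or_ne i k
        · rw [Function.update_self] at hi
          exact (mem_insert.1 hi).imp_right fun h => ⟨_, h⟩
        · rw [Function.update_of_ne hik] at hi
          exact Or.inr ⟨i, hi⟩
      · rintro (rfl | ⟨i, hi⟩)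
        · exact ⟨k, by simp⟩
        · obtain rfl | hik := eq_or_ne i k
          · exact ⟨i, by simp [hi]⟩
          · exact ⟨i, by rwa [Function.update_of_ne hik]⟩
    · intro i j e he
      refine le_trans ?_ (hle j)
      obtain rfl | hi := eq_or_ne i k
      · rw [Function.update_self] at he ⊢
        refine le_trans ?_ (hk j (mem_univ j))
        rw [cost_erase he, cost_insert (hxP i)]
        obtain rfl | he := mem_insert.1 he
        · linarith
        · linarith [hmin e (hsub i he)]
      · rw [Function.update_of_ne hi] at he ⊢
        exact hP i j e he

/-- Three agents with nonnegative additive costs always have a `5`-EFX allocation. -/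
lemma hasEFX_of_nonneg (ha : ∀ x, 0 ≤ a x) (hb : ∀ x, 0 ≤ b x) (hc : ∀ x, 0 ≤ c x)
    (M : Finset ι) : HasEFX a b c M := by
  obtain ⟨P, hdisj, hM, hP⟩ := exists_fair_partition ha M
  have hPM : ∀ i j k : Fin 3, i ≠ j → i ≠ k → j ≠ k → P i ∪ P j ∪ P k = M := by
    intro i j k hij hik hjk
    have huniv : ({i, j, k} : Finset (Fin 3)) = univ := by
      rw [← card_eq_iff_eq_univ, card_eq_three.2 ⟨i, j, k, hij, hik, hjk, rfl⟩, Fintype.card_fin]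
    rw [← hM, ← huniv, biUnion_insert, biUnion_insert, singleton_biUnion, union_assoc]
  have third : ∀ i j : Fin 3, i ≠ j → ∃ k, i ≠ k ∧ j ≠ k := by decide
  have hPa : ∀ i j, Content a (P i) (P j) := fun i j e he => by
    linarith [hP i j e he, cost_nonneg ha (P j)]
  by_contra hno
  have best : ∀ f : ι → ℝ, (∀ x, 0 ≤ f x) → ∃ k, (∀ j, cost f (P k) ≤ cost f (P j)) ∧
      ∀ j, Content f (P k) (P j) := by
    intro f hf
    obtain ⟨k, -, hk⟩ := exists_min_image univ (fun i => cost f (P i)) ⟨0, mem_univ _⟩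
    exact ⟨k, fun j => hk j (mem_univ j), fun j => content_of_le hf (by
      linarith [hk j (mem_univ j), cost_nonneg hf (P j)])⟩
  obtain ⟨k, hkmin, hk⟩ := best b hb
  obtain ⟨l, hlmin, hl⟩ := best c hc
  have same : ∀ k l, (∀ j, Content b (P k) (P j)) → (∀ j, Content c (P l) (P j)) → k = l := by
    intro k l hk hl
    by_contra hkl
    obtain ⟨i, hki, hli⟩ := third k l hkl
    exact hno ⟨P i, P k, P l, ⟨hdisj _ _ hki.symm, hdisj _ _ hli.symm, hdisj _ _ hkl,
      hPM i k l hki.symm hli.symm hkl⟩, hPa i k, hPa i l, hk i, hk l, hl i, hl k⟩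
  obtain rfl := same k l hk hl
  have bad : ∀ f : ι → ℝ, (∀ x, 0 ≤ f x) → (∀ j, cost f (P k) ≤ cost f (P j)) → ∀ i,
      ¬ (∀ j, Content f (P i) (P j)) → 5 * cost f (P k) ≤ cost f (P i) ∧ (P i).Nontrivial := by
    intro f hf hfk i hi
    push Not at hi
    obtain ⟨j, hj⟩ := hi
    obtain ⟨h1, h2⟩ := lt_and_nontrivial_of_not_content hf hj
    exact ⟨by linarith [hfk j], h2⟩
  have badb : ∀ i, k ≠ i → 5 * cost b (P k) ≤ cost b (P i) ∧ (P i).Nontrivial :=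
    fun i hi => bad b hb hkmin i fun h => hi (same i k h hl).symm
  have badc : ∀ i, k ≠ i → 5 * cost c (P k) ≤ cost c (P i) ∧ (P i).Nontrivial :=
    fun i hi => bad c hc hlmin i fun h => hi (same k i hk h)
  obtain ⟨i, hi⟩ : ∃ i, k ≠ i := (by decide : ∀ k : Fin 3, ∃ i, k ≠ i) k
  obtain ⟨j, hkj, hij⟩ := third k i hi
  refine hno ?_
  rw [← hPM k i j hi hkj hij]
  exact hasEFX_of_common_best ha hb hc (hdisj _ _ hi) (hdisj _ _ hkj) (hdisj _ _ hij) (hP i k)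
    (hP i j) (hP j k) (hP j i) (badb i hi).2 (badb j hkj).2 (badb i hi).1 (badb j hkj).1
    (badc i hi).1 (badc j hkj).1

end Allocations

end Chores

/-- For every instance with 3 agents, a finite set `M` of indivisible chores, and
additive nonnegative cost functions, there exists a `5`-EFX allocation. -/
theorem stmt_1 {ι : Type*} [DecidableEq ι] (M : Finset ι)
    (c : Fin 3 → ι → ℝ) (hc : ∀ i, ∀ e ∈ M, 0 ≤ c i e) :
    ∃ X : Fin 3 → Finset ι,
      (∀ i j, i ≠ j → Disjoint (X i) (X j)) ∧
      (Finset.univ.biUnion X = M) ∧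
      (∀ i j : Fin 3, ∀ e ∈ X i,
        ∑ f ∈ (X i).erase e, c i f ≤ 5 * ∑ f ∈ X j, c i f) := by
  obtain ⟨X, Y, Z, ⟨hXY, hXZ, hYZ, hM⟩, h01, h02, h10, h12, h20, h21⟩ :=
    hasEFX_of_nonneg (fun x => abs_nonneg (c 0 x)) (fun x => abs_nonneg (c 1 x))
      (fun x => abs_nonneg (c 2 x)) M
  have habs : ∀ i, ∀ S ⊆ M, cost (fun x => |c i x|) S = ∑ f ∈ S, c i f := fun i S hS =>
    sum_congr rfl fun x hx => abs_of_nonneg (hc i x (hS hx))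
  have hself : ∀ i, ∀ S : Finset ι, Content (fun x => |c i x|) S S := fun i S =>
    content_of_le (fun x => abs_nonneg (c i x)) (by
      linarith [cost_nonneg (fun x => abs_nonneg (c i x)) S])
  have hsub : ∀ i, (![X, Y, Z] : Fin 3 → Finset ι) i ⊆ M := by
    intro i
    rw [← hM]
    fin_cases i
    · exact subset_union_left.trans subset_union_left
    · exact subset_union_right.trans subset_union_left
    · exact subset_union_right
  have hall : ∀ i j : Fin 3, Content (fun x => |c i x|) (![X, Y, Z] i) (![X, Y, Z] j) := by
    intro i j
    fin_cases i <;> fin_cases j <;> first | assumption | exact hself _ _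
  refine ⟨![X, Y, Z], ?_, ?_, ?_⟩
  · intro i j hij
    fin_cases i <;> fin_cases j <;> first | exact absurd rfl hij | assumption |
      (apply Disjoint.symm; assumption)
  · rw [← hM]
    ext x
    simp [Fin.exists_fin_succ]
  · intro i j e he
    rw [← habs i _ ((erase_subset e _).trans (hsub i)), ← habs i _ (hsub j)]
    exact hall i j e he
end

section
/- For every instance with n agents, a finite set M of indivisible chores, and additive nonnegative cost functions, there exists a 3n²-EFX allocation; that is, an allocation X = (X_1,…,X_n) of M such that for all agents i, j and every item e ∈ X_i it holds that c_i(X_i \ {e}) ≤ 3n²·c_i(X_j). -/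
open Finset

/-- If there are at least as many items as agents, the agents can each be given one item so that
everyone weakly prefers their item to every item left over. -/
theorem exists_injective_dominating {ι P : Type*} [DecidableEq ι] [Fintype P] [DecidableEq P]
    (Z : Finset ι) (v : P → ι → ℝ) (h : Fintype.card P ≤ #Z) :
    ∃ g : P → ι, Function.Injective g ∧ (∀ p, g p ∈ Z) ∧
      ∀ p, ∀ e ∈ Z, (∀ q, g q ≠ e) → v p e ≤ v p (g p) := by
  classical
  have hne : Nonempty (P ↪ Z) :=
    Function.Embedding.nonempty_of_card_le (by simpa using h)
  obtain ⟨g, hg⟩ := Finite.exists_max (fun g : P ↪ Z => ∑ p, v p (g p))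
  refine ⟨fun p => g p, fun p q hpq => g.injective (Subtype.ext hpq), fun p => (g p).2, ?_⟩
  intro p e he hfree
  have hinj : Function.Injective (Function.update g p ⟨e, he⟩) := by
    intro q r hqr
    by_cases hq : q = p <;> by_cases hr : r = p
    · rw [hq, hr]
    · subst hq
      rw [Function.update_self, Function.update_of_ne hr] at hqr
      exact absurd (congrArg Subtype.val hqr).symm (hfree r)
    · subst hr
      rw [Function.update_self, Function.update_of_ne hq] at hqr
      exact absurd (congrArg Subtype.val hqr) (hfree q)
    · rw [Function.update_of_ne hq, Function.update_of_ne hr] at hqr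
      exact g.injective hqr
  have hmax := hg ⟨_, hinj⟩
  simp only [Function.Embedding.coeFn_mk] at hmax
  rw [← Finset.add_sum_erase _ _ (mem_univ p),
    ← Finset.add_sum_erase _ (fun q => v q (g q)) (mem_univ p), Function.update_self] at hmax
  have hrest : ∑ q ∈ univ.erase p, v q (Function.update g p ⟨e, he⟩ q)
      = ∑ q ∈ univ.erase p, v q (g q) :=
    Finset.sum_congr rfl fun q hq => by rw [Function.update_of_ne (ne_of_mem_erase hq)]
  linarith

/-- Round robin for goods: each agent receives her proportional share up to one item. -/
theorem exists_proportional_up_to_one {ι P : Type*} [DecidableEq ι] [Fintype P] [DecidableEq P]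
    [Nonempty P] (v : P → ι → ℝ) (Z : Finset ι) (hv : ∀ p, ∀ e ∈ Z, 0 ≤ v p e)
    (b : P → ℝ) (hb : ∀ p, 0 ≤ b p) (hvb : ∀ p, ∀ e ∈ Z, v p e ≤ b p) :
    ∃ φ : ι → P, ∀ p,
      ∑ e ∈ Z, v p e ≤ Fintype.card P * (∑ e ∈ Z with φ e = p, v p e + b p) := by
  induction Z using Finset.strongInduction generalizing b with
  | H Z ih =>
  have hP : 0 < Fintype.card P := Fintype.card_pos
  rcases lt_or_ge (#Z) (Fintype.card P) with hlt | hge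
  · refine ⟨fun _ => Classical.arbitrary P, fun p => ?_⟩
    have h1 : ∑ e ∈ Z, v p e ≤ #Z * b p := by
      simpa using Finset.sum_le_card_nsmul Z (v p) (b p) (hvb p)
    have h2 : (#Z : ℝ) ≤ Fintype.card P := by exact_mod_cast hlt.le
    have h3 : 0 ≤ ∑ e ∈ Z with Classical.arbitrary P = p, v p e :=
      Finset.sum_nonneg fun e he => hv p e (mem_filter.1 he).1
    calc _ ≤ #Z * b p := h1
      _ ≤ Fintype.card P * b p := mul_le_mul_of_nonneg_right h2 (hb p)
      _ ≤ _ := by gcongr; linarith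
  · obtain ⟨g, ginj, gZ, gdom⟩ := exists_injective_dominating Z v hge
    have himg : univ.image g ⊆ Z := by
      intro e he
      obtain ⟨p, -, rfl⟩ := mem_image.1 he
      exact gZ p
    have hcard : #(univ.image g) = Fintype.card P := by
      rw [card_image_of_injective _ ginj, card_univ]
    have hss : Z \ univ.image g ⊂ Z := by
      refine sdiff_ssubset himg (card_pos.1 (by omega))
    obtain ⟨φ, hφ⟩ := ih _ hss (fun p e he => hv p e (mem_sdiff.1 he).1) (fun p => v p (g p))
      (fun p => hv p _ (gZ p)) (fun p e he => gdom p e (mem_sdiff.1 he).1 (fun q hq =>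
        (mem_sdiff.1 he).2 (mem_image.2 ⟨q, mem_univ q, hq⟩)))
    classical
    refine ⟨fun e => if h : ∃ p, g p = e then h.choose else φ e, fun p => ?_⟩
    have hψ : ∀ q, (if h : ∃ p, g p = g q then h.choose else φ (g q)) = q := by
      intro q
      have h : ∃ p, g p = g q := ⟨q, rfl⟩
      rw [dif_pos h]
      exact ginj h.choose_spec
    have hsplit := Finset.sum_sdiff (f := v p) himg
    have htop : ∑ e ∈ univ.image g, v p e ≤ Fintype.card P * b p := by
      have := Finset.sum_le_card_nsmul (univ.image g) (v p) (b p) (fun e he => hvb p e (himg he))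
      rwa [hcard, nsmul_eq_mul] at this
    have hpart : ∑ e ∈ Z \ univ.image g with φ e = p, v p e + v p (g p) ≤
        ∑ e ∈ Z with (if h : ∃ p, g p = e then h.choose else φ e) = p, v p e := by
      have hnot : g p ∉ ({e ∈ Z \ univ.image g | φ e = p} : Finset ι) := by simp
      rw [add_comm, ← Finset.sum_insert hnot]
      refine Finset.sum_le_sum_of_subset_of_nonneg ?_
        (fun e he _ => hv p e (mem_filter.1 he).1)
      intro e he
      rcases mem_insert.1 he with rfl | he
      · exact mem_filter.2 ⟨gZ p, hψ p⟩
      · obtain ⟨he, hep⟩ := mem_filter.1 he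
        obtain ⟨heZ, hne⟩ := mem_sdiff.1 he
        refine mem_filter.2 ⟨heZ, ?_⟩
        rw [dif_neg (fun ⟨q, hq⟩ => hne (mem_image.2 ⟨q, mem_univ q, hq⟩))]
        exact hep
    have := hφ p
    have hmul := mul_le_mul_of_nonneg_left hpart (Nat.cast_nonneg (α := ℝ) (Fintype.card P))
    rw [mul_add]
    linarith

/-- The items of `M` that are large for all agents in `R`. -/
def commonLarge {ι : Type*} [DecidableEq ι] {n : ℕ} (M : Finset ι) (L : Fin n → Finset ι)
    (R : Finset (Fin n)) : Finset ι :=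
  {e ∈ M | ∀ j ∈ R, e ∈ L j}

/-- There is a set of items that is maximal among the sets of fewer than `n` items which are all
worth at least a `1 / K` fraction of the rest. -/
theorem exists_large_items {ι : Type*} [DecidableEq ι] (n : ℕ) (hn : 1 ≤ n) (M : Finset ι)
    (c : ι → ℝ) (hc : ∀ e ∈ M, 0 ≤ c e) (K : ℝ) :
    ∃ L ⊆ M, #L < n ∧ (∀ e ∈ L, ∑ f ∈ M \ L, c f ≤ K * c e) ∧
      (#L + 1 < n → ∀ e ∈ M \ L, K * c e ≤ ∑ f ∈ M \ L, c f) := by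
  classical
  let F := {L ∈ M.powerset | #L < n ∧ ∀ e ∈ L, ∑ f ∈ M \ L, c f ≤ K * c e}
  have hF : F.Nonempty := ⟨∅, by simp [F]; omega⟩
  obtain ⟨L, hL, hmax⟩ := F.exists_max_image card hF
  simp only [F, mem_filter, mem_powerset] at hL hmax
  refine ⟨L, hL.1, hL.2.1, hL.2.2, fun hlt e he => ?_⟩
  by_contra! hbig
  obtain ⟨heM, heL⟩ := mem_sdiff.1 he
  have hle : ∑ f ∈ M \ insert e L, c f ≤ ∑ f ∈ M \ L, c f :=
    Finset.sum_le_sum_of_subset_of_nonneg (sdiff_subset_sdiff le_rfl (subset_insert _ _))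
      (fun f hf _ => hc f (mem_sdiff.1 hf).1)
  have := hmax (insert e L) ⟨insert_subset heM hL.1, by rw [card_insert_of_notMem heL]; exact hlt,
    fun f hf => by
      rcases mem_insert.1 hf with rfl | hf
      · linarith
      · exact hle.trans (hL.2.2 f hf)⟩
  rw [card_insert_of_notMem heL] at this
  omega

/-- If every agent has fewer than `n - 1` large items, some nonempty set of agents can be
completed to all `n` agents by as many agents as there are items large for the whole set. -/
theorem exists_balanced_agents {ι : Type*} [DecidableEq ι] {n : ℕ} (hn : 1 ≤ n) (M : Finset ι)
    (L : Fin n → Finset ι) (hL : ∀ i, #(L i) + 1 < n) :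
    ∃ R : Finset (Fin n), R.Nonempty ∧ #(commonLarge M L R) + #R = n := by
  classical
  let F := {R : Finset (Fin n) | R.Nonempty ∧ n ≤ #(commonLarge M L R) + #R}
  have hF : F.Nonempty := ⟨univ, ⟨⟨0, hn⟩, mem_univ _⟩, by simp⟩
  obtain ⟨R, hR, hmin⟩ := Set.exists_min_image F card (Set.toFinite F) hF
  obtain ⟨⟨r, hr⟩, hle⟩ := hR
  refine ⟨R, ⟨r, hr⟩, le_antisymm ?_ hle⟩
  have hUr : #(commonLarge M L R) ≤ #(L r) :=
    card_le_card fun e he => (mem_filter.1 he).2 r hr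
  have hRr := hL r
  have hcard := card_erase_of_mem hr
  have hne : (R.erase r).Nonempty := card_pos.1 (by omega)
  have hsub : #(commonLarge M L R) ≤ #(commonLarge M L (R.erase r)) :=
    card_le_card fun e he => mem_filter.2
      ⟨(mem_filter.1 he).1, fun j hj => (mem_filter.1 he).2 j (mem_of_mem_erase hj)⟩
  by_contra! hlt
  have := hmin (R.erase r) ⟨hne, by omega⟩
  omega

/-- Hand the items that are large for all of `R` to the agents outside `R`, one each, and the
other items to `R` as prescribed by `b`. -/
theorem exists_allocation_of_partial {ι : Type*} [DecidableEq ι] {n : ℕ} (M : Finset ι)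
    (c : Fin n → ι → ℝ) (hc : ∀ i, ∀ e ∈ M, 0 ≤ c i e) (K : ℝ) (hK : 1 ≤ K)
    (L : Fin n → Finset ι) (hLK : ∀ i, ∀ e ∈ L i, ∑ f ∈ M \ L i, c i f ≤ K * c i e)
    (R : Finset (Fin n)) (hR : #(commonLarge M L R) + #R = n)
    (b : ι → Fin n) (hbR : ∀ e, b e ∈ R)
    (hbL : ∀ e ∈ M \ commonLarge M L R, e ∉ L (b e))
    (hb : ∀ i ∈ R, ∀ j ∈ R, i ≠ j → ∑ f ∈ M \ L i, c i f ≤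
      K * ∑ f ∈ M \ commonLarge M L R with b f = j, c i f) :
    ∃ X : Fin n → Finset ι,
      (∀ i j, i ≠ j → Disjoint (X i) (X j)) ∧
      (Finset.univ.biUnion X = M) ∧
      (∀ i j : Fin n, ∀ e ∈ X i,
        ∑ f ∈ (X i).erase e, c i f ≤ K * ∑ f ∈ X j, c i f) := by
  classical
  set U := commonLarge M L R
  have hUM : U ⊆ M := filter_subset _ _
  have hcard : #U = #Rᶜ := by rw [card_compl, Fintype.card_fin]; omega
  let σ : U ≃ ↥Rᶜ := Finset.equivOfCardEq hcard
  let a : ι → Fin n := fun e => if h : e ∈ U then σ ⟨e, h⟩ else b e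
  have haU : ∀ e (h : e ∈ U), a e = σ ⟨e, h⟩ := fun e h => dif_pos h
  have hab : ∀ e, e ∉ U → a e = b e := fun e h => dif_neg h
  have haR : ∀ e, a e ∈ R → e ∉ U := fun e h hU => by
    rw [haU e hU] at h
    exact mem_compl.1 (σ ⟨e, hU⟩).2 h
  have hX0 : ∀ i j, 0 ≤ ∑ f ∈ M with a f = j, c i f := fun i j =>
    Finset.sum_nonneg fun f hf => hc i f (mem_filter.1 hf).1
  refine ⟨fun i => {e ∈ M | a e = i}, ?_, ?_, ?_⟩
  · intro i j hij
    rw [Finset.disjoint_left]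
    intro e hi hj
    exact hij ((mem_filter.1 hi).2.symm.trans (mem_filter.1 hj).2)
  · ext e
    simp
  intro i j e he
  have hpos : 0 ≤ K * ∑ f ∈ M with a f = j, c i f := mul_nonneg (by linarith) (hX0 i j)
  by_cases hi : i ∈ R
  · have hown : ∑ f ∈ ({f ∈ M | a f = i} : Finset ι).erase e, c i f ≤
        ∑ f ∈ M with a f = i, c i f :=
      Finset.sum_le_sum_of_subset_of_nonneg (erase_subset _ _)
        (fun f hf _ => hc i f (mem_filter.1 hf).1)
    by_cases hij : i = j
    · subst hij
      nlinarith [hX0 i i]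
    have hsmall : ∑ f ∈ M with a f = i, c i f ≤ ∑ f ∈ M \ L i, c i f := by
      refine Finset.sum_le_sum_of_subset_of_nonneg ?_ (fun f hf _ => hc i f (mem_sdiff.1 hf).1)
      intro f hf
      obtain ⟨hfM, hfi⟩ := mem_filter.1 hf
      have hfU := haR f (hfi ▸ hi)
      have := hbL f (mem_sdiff.2 ⟨hfM, hfU⟩)
      rw [← hab f hfU, hfi] at this
      exact mem_sdiff.2 ⟨hfM, this⟩
    refine (hown.trans hsmall).trans ?_
    by_cases hj : j ∈ R
    · refine (hb i hi j hj hij).trans (mul_le_mul_of_nonneg_left ?_ (by linarith))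
      refine Finset.sum_le_sum_of_subset_of_nonneg ?_ (fun f hf _ => hc i f (mem_filter.1 hf).1)
      intro f hf
      obtain ⟨hf, hfj⟩ := mem_filter.1 hf
      obtain ⟨hfM, hfU⟩ := mem_sdiff.1 hf
      exact mem_filter.2 ⟨hfM, (hab f hfU).trans hfj⟩
    · obtain ⟨⟨u, hu⟩, huj⟩ := σ.surjective ⟨j, mem_compl.2 hj⟩
      have huX : u ∈ ({f ∈ M | a f = j} : Finset ι) :=
        mem_filter.2 ⟨hUM hu, by rw [haU u hu, huj]⟩
      refine (hLK i u ((mem_filter.1 hu).2 i hi)).trans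
        (mul_le_mul_of_nonneg_left ?_ (by linarith))
      exact Finset.single_le_sum (f := c i) (fun f hf => hc i f (mem_filter.1 hf).1) huX
  · have hzero : ({f ∈ M | a f = i} : Finset ι).erase e = ∅ := by
      refine eq_empty_of_forall_notMem fun f hf => ?_
      have hmem : ∀ g, a g = i → g ∈ U := fun g hg => by
        by_contra hgU
        exact hi (hg ▸ hab g hgU ▸ hbR g)
      obtain ⟨hfe, hf⟩ := mem_erase.1 hf
      have hfi := (mem_filter.1 hf).2
      have hei := (mem_filter.1 he).2
      have h := (haU f (hmem f hfi)).symm.trans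
        ((hfi.trans hei.symm).trans (haU e (hmem e hei)))
      exact hfe (congrArg Subtype.val (σ.injective (Subtype.ext h)))
    simpa only [hzero, sum_empty] using hpos

/-- For every instance with `n` agents (`n ≥ 1`), a finite set `M` of indivisible
chores, and additive nonnegative cost functions, there exists a `3n²`-EFX allocation. -/
theorem stmt_7 {ι : Type*} [DecidableEq ι] (n : ℕ) (hn : 1 ≤ n) (M : Finset ι)
    (c : Fin n → ι → ℝ) (hc : ∀ i, ∀ e ∈ M, 0 ≤ c i e) :
    ∃ X : Fin n → Finset ι,
      (∀ i j, i ≠ j → Disjoint (X i) (X j)) ∧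
      (Finset.univ.biUnion X = M) ∧
      (∀ i j : Fin n, ∀ e ∈ X i,
        ∑ f ∈ (X i).erase e, c i f ≤ 3 * (n : ℝ) ^ 2 * ∑ f ∈ X j, c i f) := by
  classical
  have hn' : (1 : ℝ) ≤ n := by exact_mod_cast hn
  have hK : (1 : ℝ) ≤ 3 * (n : ℝ) ^ 2 := by nlinarith
  choose L hLM hLn hLK hLsmall using fun i =>
    exists_large_items n hn M (c i) (hc i) (3 * (n : ℝ) ^ 2)
  by_cases hfull : ∃ i, #(L i) + 1 = n
  · obtain ⟨i, hi⟩ := hfull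
    have hU : commonLarge M L {i} = L i := by
      ext e
      simpa [commonLarge] using fun he => hLM i he
    refine exists_allocation_of_partial M c hc _ hK L hLK {i} (by simpa [hU] using hi)
      (fun _ => i) (by simp) ?_ ?_
    · intro e he
      rw [hU] at he
      exact (mem_sdiff.1 he).2
    · intro j hj k hk hjk
      exact absurd ((mem_singleton.1 hj).trans (mem_singleton.1 hk).symm) hjk
  push Not at hfull
  have hlt : ∀ i, #(L i) + 1 < n := fun i => lt_of_le_of_ne (hLn i) (hfull i)
  obtain ⟨R, ⟨r, hr⟩, hR⟩ := exists_balanced_agents hn M L hlt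
  let Q := R.biUnion L
  let w : Fin n → ℝ := fun i => ∑ f ∈ M \ L i, c i f
  have hw : ∀ i, 0 ≤ w i := fun i => Finset.sum_nonneg fun f hf => hc i f (mem_sdiff.1 hf).1
  have hQ : (#Q : ℝ) ≤ (n : ℝ) ^ 2 := by
    have h1 : #Q ≤ #R * n := card_biUnion_le_card_mul _ _ _ fun i _ => (hLn i).le
    have h2 : #R ≤ n := by omega
    have : #Q ≤ n ^ 2 := h1.trans (by nlinarith)
    exact_mod_cast this
  have hZL : ∀ i ∈ R, ∀ e ∈ M \ Q, e ∈ M \ L i := fun i hi e he =>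
    mem_sdiff.2 ⟨(mem_sdiff.1 he).1,
      fun h => (mem_sdiff.1 he).2 (mem_biUnion.2 ⟨i, hi, h⟩)⟩
  -- All items outside `Q` cost little to every agent in `R`; split them as if they were goods.
  have : Nonempty (R × R) := ⟨(⟨r, hr⟩, ⟨r, hr⟩)⟩
  obtain ⟨φ, hφ⟩ := exists_proportional_up_to_one (P := R × R) (fun p => c p.1) (M \ Q)
    (fun p e he => hc _ e (mem_sdiff.1 he).1) (fun p => w p.1 / (3 * (n : ℝ) ^ 2))
    (fun p => div_nonneg (hw _) (by positivity))
    (fun p e he => by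
      rw [le_div_iff₀' (by positivity)]
      exact hLsmall _ (hlt _) e (hZL _ p.1.2 e he))
  have hbQ : ∀ e, ∃ j ∈ R, (e ∈ M \ commonLarge M L R → e ∉ L j) ∧
      (e ∈ M \ Q → j = (φ e).2) := by
    intro e
    by_cases heQ : e ∈ M \ Q
    · exact ⟨(φ e).2, (φ e).2.2, fun _ => (mem_sdiff.1 (hZL _ (φ e).2.2 e heQ)).2, fun _ => rfl⟩
    by_cases heU : e ∈ M \ commonLarge M L R
    · obtain ⟨heM, heU⟩ := mem_sdiff.1 heU
      have : ∃ j ∈ R, e ∉ L j := by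
        by_contra! h
        exact heU (mem_filter.2 ⟨heM, h⟩)
      obtain ⟨j, hj, hej⟩ := this
      exact ⟨j, hj, fun _ => hej, fun h => absurd h heQ⟩
    · exact ⟨r, hr, fun h => absurd h heU, fun h => absurd h heQ⟩
  choose b hbR hbL hbφ using hbQ
  refine exists_allocation_of_partial M c hc _ hK L hLK R hR b hbR hbL ?_
  intro i hi j hj _
  have hsub : ∑ e ∈ M \ Q with φ e = (⟨i, hi⟩, ⟨j, hj⟩), c i e ≤
      ∑ f ∈ M \ commonLarge M L R with b f = j, c i f := by
    refine Finset.sum_le_sum_of_subset_of_nonneg ?_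
      (fun f hf _ => hc i f (mem_sdiff.1 (mem_filter.1 hf).1).1)
    intro f hf
    obtain ⟨hf, hfφ⟩ := mem_filter.1 hf
    refine mem_filter.2 ⟨mem_sdiff.2 ⟨(mem_sdiff.1 hf).1, fun hfU => ?_⟩, ?_⟩
    · exact (mem_sdiff.1 (hZL i hi f hf)).2 ((mem_filter.1 hfU).2 i hi)
    · rw [hbφ f hf, hfφ]
  have hw_le : w i ≤ ∑ e ∈ M \ Q, c i e + w i / 3 := by
    have hss : M \ Q ⊆ M \ L i := hZL i hi
    have hsplit := Finset.sum_sdiff (f := c i) hss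
    have hmid : ∑ e ∈ (M \ L i) \ (M \ Q), c i e ≤
        #((M \ L i) \ (M \ Q)) * (w i / (3 * (n : ℝ) ^ 2)) := by
      rw [← nsmul_eq_mul]
      refine Finset.sum_le_card_nsmul _ _ _ fun e he => ?_
      rw [le_div_iff₀' (by positivity)]
      exact hLsmall i (hlt i) e (mem_sdiff.1 he).1
    have hcardQ : (#((M \ L i) \ (M \ Q)) : ℝ) ≤ (n : ℝ) ^ 2 := by
      refine le_trans ?_ hQ
      exact_mod_cast card_le_card fun e he => by
        obtain ⟨h1, h2⟩ := mem_sdiff.1 he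
        by_contra h3
        exact h2 (mem_sdiff.2 ⟨(mem_sdiff.1 h1).1, h3⟩)
    have hthird : (n : ℝ) ^ 2 * (w i / (3 * (n : ℝ) ^ 2)) = w i / 3 := by
      field_simp
    have := mul_le_mul_of_nonneg_right hcardQ
      (div_nonneg (hw i) (by positivity : (0 : ℝ) ≤ 3 * (n : ℝ) ^ 2))
    change ∑ f ∈ M \ L i, c i f ≤ _
    linarith
  have hshare := hφ (⟨i, hi⟩, ⟨j, hj⟩)
  simp only [Fintype.card_prod, Fintype.card_coe] at hshare
  have hcardP : ((#R * #R : ℕ) : ℝ) ≤ (n : ℝ) ^ 2 := by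
    have h2 : #R ≤ n := by omega
    exact_mod_cast (by nlinarith : #R * #R ≤ n ^ 2)
  set S := ∑ e ∈ M \ Q with φ e = (⟨i, hi⟩, ⟨j, hj⟩), c i e
  have hS0 : 0 ≤ S := Finset.sum_nonneg fun f hf =>
    hc i f (mem_sdiff.1 (mem_filter.1 hf).1).1
  have hshare' : ∑ e ∈ M \ Q, c i e ≤ (n : ℝ) ^ 2 * S + w i / 3 := by
    refine hshare.trans ((mul_le_mul_of_nonneg_right hcardP
      (add_nonneg hS0 (div_nonneg (hw i) (by positivity)))).trans_eq ?_)
    field_simp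
  have := mul_le_mul_of_nonneg_left hsub (by positivity : (0 : ℝ) ≤ 3 * (n : ℝ) ^ 2)
  change w i ≤ _
  linarith
end

section
/- Let there be 3 agents and a finite set M of indivisible chores with additive bi-valued cost functions taking values in {ε, 1} for some 0 ≤ ε < 1, and suppose no two agents have identical cost functions. If there exists an item that is small only to some agent — i.e., an item e and an agent i with c_i(e) = ε and c_j(e) = 1 for both agents j ≠ i — then there exists an EFX allocation. -/
open Finset

/-- The cost type of an item: which of the three agents find it small. -/
abbrev CostType := Bool × Bool × Bool

namespace CostType

/-- Whether items of type `t` are large to agent `i`. -/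
def large (i : Fin 3) (t : CostType) : Bool :=
  match i with
  | 0 => !t.1
  | 1 => !t.2.1
  | 2 => !t.2.2

/-- A multiset of item types can be split into three bundles such that each agent `i` has at most
as many large items as `i` sees in any other bundle, and bundle sizes differ by at most one. -/
def Splittable (m : Multiset CostType) : Prop :=
  ∃ Y : Fin 3 → Multiset CostType, ∑ i, Y i = m ∧
    ∀ i j, (Y i).card ≤ (Y j).card + 1 ∧
      (Y i).countP (large i ·) ≤ (Y j).countP (large i ·)

/-- Giving `t i` to agent `i` creates no envy in terms of large items. -/
def Neutral (t : Fin 3 → CostType) : Prop :=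
  ∀ i j, large i (t i) → large i (t j)

lemma Splittable.add_neutral {m : Multiset CostType} (hm : Splittable m)
    {t : Fin 3 → CostType} (ht : Neutral t) : Splittable (∑ i, {t i} + m) := by
  obtain ⟨Y, rfl, hY⟩ := hm
  refine ⟨fun i => {t i} + Y i, Finset.sum_add_distrib, fun i j => ?_⟩
  obtain ⟨h1, h2⟩ := hY i j
  have h := ht i j
  constructor
  · simp only [Multiset.card_add, Multiset.card_singleton]; omega
  · simp only [Multiset.countP_add, ← Multiset.cons_zero, Multiset.countP_cons,
      Multiset.countP_zero]
    split_ifs <;> first | omega | simp_all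

/-- Agent `i`, holding `A`, satisfies the requirements of `Splittable` towards `B`. -/
def noEnvy (i : Fin 3) (A B : List CostType) : Bool :=
  Nat.ble A.length (B.length + 1) && Nat.ble (A.countP (large i)) (B.countP (large i))

/-- Exhaustive search for a way of extending the bundles `A`, `B`, `C` by the items in a list. -/
def search : List CostType → List CostType → List CostType → List CostType → Bool
  | [], A, B, C => noEnvy 0 A B && noEnvy 0 A C && noEnvy 1 B A && noEnvy 1 B C &&
      noEnvy 2 C A && noEnvy 2 C B
  | t :: l, A, B, C => search l (t :: A) B C || search l A (t :: B) C || search l A B (t :: C)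

lemma splittable_of_search (l A B C : List CostType) (h : search l A B C = true) :
    Splittable (l + A + B + C) := by
  induction l generalizing A B C with
  | nil =>
    simp only [search, noEnvy, Bool.and_eq_true, Nat.ble_eq] at h
    have hcount : ∀ i (D : List CostType),
        Multiset.countP (large i ·) (D : Multiset CostType) = D.countP (large i) := by
      simp [Multiset.coe_countP]
    refine ⟨![A, B, C], by simp [Fin.sum_univ_three], fun i j => ?_⟩
    fin_cases i <;> fin_cases j <;> simp [hcount] <;> omega
  | cons t l ih =>
    simp only [search, Bool.or_eq_true] at h
    rcases h with (h | h) | h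
    all_goals
      convert ih _ _ _ h using 1
      simp only [← Multiset.cons_coe, Multiset.cons_add, Multiset.add_cons]

/-- Whether a list contains distinct entries `x`, `y`, `z` small to agents 0, 1, 2 respectively. -/
def hasSmallTriple (l : List CostType) : Bool :=
  l.any fun x => x.1 && (l.erase x).any fun y => y.2.1 && ((l.erase x).erase y).any fun z => z.2.2

lemma exists_neutral_of_hasSmallTriple {l : List CostType} (h : hasSmallTriple l = true) :
    ∃ t : Fin 3 → CostType, Neutral t ∧ ∑ i, {t i} ≤ (l : Multiset CostType) := by
  simp only [hasSmallTriple, List.any_eq_true, Bool.and_eq_true] at h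
  obtain ⟨x, hx, hx0, y, hy, hy1, z, hz, hz2⟩ := h
  refine ⟨![x, y, z], ?_, ?_⟩
  · intro i j
    fin_cases i <;> simp [large, hx0, hy1, hz2]
  · have h : (l : Multiset CostType) = x ::ₘ y ::ₘ z ::ₘ (((l.erase x).erase y).erase z : List _) := by
      simp only [Multiset.cons_coe, Multiset.coe_eq_coe]
      exact (List.perm_cons_erase hx).trans
        (((List.perm_cons_erase hy).trans ((List.perm_cons_erase hz).cons _)).cons _)
    rw [h]
    refine Multiset.le_iff_exists_add.2 ⟨(((l.erase x).erase y).erase z : List _), ?_⟩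
    simp [Fin.sum_univ_three, ← Multiset.singleton_add, add_assoc]

/-- The list with prescribed multiplicities of each type that is small to some agent. -/
def ofCounts (k₁ k₂ k₃ k₄ k₅ k₆ k₇ : ℕ) : List CostType :=
  .replicate k₁ (true, true, true) ++ .replicate k₂ (true, true, false) ++
  .replicate k₃ (true, false, true) ++ .replicate k₄ (true, false, false) ++
  .replicate k₅ (false, true, true) ++ .replicate k₆ (false, true, false) ++
  .replicate k₇ (false, false, true)

/-- Starting from an item small only to agent 0, an item small to agent 1 but not to agent 2, and
up to two items that are large to everyone, the search can place the items of `l`. -/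
def extendable (l : List CostType) : Bool :=
  [true, false].all fun b =>
    search l [(true, false, false)] [(b, true, false)] [] &&
    search l [(true, false, false)] [(b, true, false)] [(false, false, false)] &&
    search l [(true, false, false)] [(b, true, false), (false, false, false)]
      [(false, false, false)]

lemma hasSmallTriple_or_extendable : ∀ k₁ k₂ k₃ k₄ k₅ k₆ k₇ : Fin 3,
    (hasSmallTriple (ofCounts k₁ k₂ k₃ k₄ k₅ k₆ k₇) ||
      extendable (ofCounts k₁ k₂ k₃ k₄ k₅ k₆ k₇)) = true := by
  decide +kernel

lemma eq_ofCounts (m : Multiset CostType) :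
    m = Multiset.replicate (m.count (false, false, false)) (false, false, false) +
      ofCounts (m.count (true, true, true)) (m.count (true, true, false))
        (m.count (true, false, true)) (m.count (true, false, false))
        (m.count (false, true, true)) (m.count (false, true, false))
        (m.count (false, false, true)) := by
  ext ⟨a, b, c⟩
  cases a <;> cases b <;> cases c <;>
    simp [ofCounts, List.count_replicate, Multiset.count_replicate]

lemma exists_neutral_or_splittable (m : Multiset CostType) (b : Bool) :
    (∃ t : Fin 3 → CostType, Neutral t ∧ ∑ i, {t i} ≤ m) ∨
      Splittable ({(true, false, false)} + {(b, true, false)} + m) := by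
  by_cases hc : ∃ t, 3 ≤ m.count t
  · obtain ⟨t, ht⟩ := hc
    refine .inl ⟨fun _ => t, fun _ _ => id, ?_⟩
    rw [Finset.sum_const, Finset.card_univ, Fintype.card_fin, Multiset.nsmul_singleton]
    exact Multiset.le_count_iff_replicate_le.1 ht
  push Not at hc
  have h := hasSmallTriple_or_extendable
    ⟨_, hc (true, true, true)⟩ ⟨_, hc (true, true, false)⟩ ⟨_, hc (true, false, true)⟩
    ⟨_, hc (true, false, false)⟩ ⟨_, hc (false, true, true)⟩ ⟨_, hc (false, true, false)⟩
    ⟨_, hc (false, false, true)⟩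
  have hm := eq_ofCounts m
  generalize ofCounts _ _ _ _ _ _ _ = l at h hm
  rcases Bool.or_eq_true _ _ ▸ h with h | h
  · obtain ⟨t, ht, hle⟩ := exists_neutral_of_hasSmallTriple h
    exact .inl ⟨t, ht, hm ▸ hle.trans (Multiset.le_add_left _ _)⟩
  · right
    have hz := hc (false, false, false)
    have hb : b ∈ [true, false] := by cases b <;> simp
    have h := List.all_eq_true.1 h b hb
    simp only [Bool.and_eq_true] at h
    obtain ⟨⟨h0, h1⟩, h2⟩ := h
    rw [hm]
    generalize m.count (false, false, false) = z at hz
    interval_cases z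
    · convert splittable_of_search _ _ _ _ h0 using 1
      simp [← Multiset.singleton_add, ← Multiset.cons_coe]
      abel
    · convert splittable_of_search _ _ _ _ h1 using 1
      simp [← Multiset.singleton_add, ← Multiset.cons_coe, Multiset.replicate_succ]
      abel
    · convert splittable_of_search _ _ _ _ h2 using 1
      simp [← Multiset.singleton_add, ← Multiset.cons_coe, Multiset.replicate_succ]
      abel

lemma splittable_of_distinguished (m : Multiset CostType) (b : Bool) :
    Splittable ({(true, false, false)} + {(b, true, false)} + m) := by
  induction hn : m.card using Nat.strong_induction_on generalizing m with
  | _ n ih =>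
    rcases exists_neutral_or_splittable m b with ⟨t, ht, hle⟩ | h
    · obtain ⟨m', rfl⟩ := Multiset.le_iff_exists_add.1 hle
      have h := (ih m'.card (by simp [← hn]) m' rfl).add_neutral ht
      rwa [add_left_comm] at h
    · exact h

end CostType

open CostType

/-- A decomposition of the multiset of types of the items of `M` lifts to a partition of `M`. -/
lemma Finset.exists_partition_of_map_eq_sum {ι α κ : Type*} [DecidableEq ι] [Fintype κ]
    [DecidableEq κ] (t : ι → α) (Y : κ → Multiset α) (M : Finset ι)
    (h : M.val.map t = ∑ i, Y i) :
    ∃ X : κ → Finset ι, (∀ i j, i ≠ j → Disjoint (X i) (X j)) ∧ Finset.univ.biUnion X = M ∧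
      ∀ i, (X i).val.map t = Y i := by
  induction M using Finset.induction_on generalizing Y with
  | empty =>
    have h0 : ∀ i, Y i = 0 := fun i => by simpa using Finset.sum_eq_zero_iff.1 h.symm i
    exact ⟨fun _ => ∅, by simp, by ext; simp, by simp [h0]⟩
  | insert a M ha ih =>
    classical
    rw [Finset.insert_val_of_notMem ha, Multiset.map_cons] at h
    obtain ⟨k, -, hk⟩ : ∃ k ∈ Finset.univ, t a ∈ Y k :=
      Multiset.mem_sum.1 (h ▸ Multiset.mem_cons_self _ _)
    obtain ⟨Z, hZ⟩ := Multiset.exists_cons_of_mem hk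
    obtain ⟨X, hdisj, rfl, hX⟩ := ih (Function.update Y k Z) <| by
      rw [Finset.sum_update_of_mem (Finset.mem_univ k)]
      rw [Finset.sum_eq_add_sum_sdiff_singleton_of_mem (Finset.mem_univ k), hZ,
        Multiset.cons_add] at h
      exact (Multiset.cons_inj_right _).1 h
    have haX : ∀ i, a ∉ X i := fun i hi => ha (Finset.mem_biUnion.2 ⟨i, Finset.mem_univ _, hi⟩)
    refine ⟨fun i => if i = k then insert a (X i) else X i, fun i j hij => ?_, ?_, fun i => ?_⟩
    · have := hdisj i j hij
      dsimp only
      split_ifs with hi hj hj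
      · exact absurd (hi.trans hj.symm) hij
      · simp [haX, this]
      · simp [haX, this]
      · exact this
    · ext g
      simp only [Finset.mem_biUnion, Finset.mem_univ, true_and, Finset.mem_insert]
      constructor
      · rintro ⟨i, hi⟩
        split_ifs at hi
        · exact (Finset.mem_insert.1 hi).imp id fun h => ⟨i, h⟩
        · exact .inr ⟨i, hi⟩
      · rintro (rfl | ⟨i, hi⟩)
        · exact ⟨k, by simp⟩
        · refine ⟨i, ?_⟩
          split_ifs <;> simp [hi]
    · have := hX i
      dsimp only
      split_ifs with hi
      · subst hi
        rw [Finset.insert_val_of_notMem (haX i), Multiset.map_cons, this, hZ,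
          Function.update_self]
      · rwa [Function.update_of_ne hi] at this

/-- An allocation whose bundles have nearly equal sizes and in which nobody has more large items
than in any other bundle is EFX. -/
lemma sum_erase_le_sum {ι : Type*} [DecidableEq ι] {c : ι → ℝ} {ε : ℝ} (hε0 : 0 ≤ ε) (hε1 : ε < 1)
    {A B : Finset ι} (hA : ∀ e ∈ A, c e = ε ∨ c e = 1) (hB : ∀ e ∈ B, c e = ε ∨ c e = 1)
    (hcard : #A ≤ #B + 1) (hlarge : #{e ∈ A | c e ≠ ε} ≤ #{e ∈ B | c e ≠ ε})
    {e : ι} (he : e ∈ A) : ∑ f ∈ A.erase e, c f ≤ ∑ f ∈ B, c f := by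
  have key : ∀ S : Finset ι, (∀ e ∈ S, c e = ε ∨ c e = 1) →
      ∑ f ∈ S, c f = (1 - ε) * #{e ∈ S | c e ≠ ε} + ε * #S := by
    intro S hS
    rw [Finset.card_filter, Finset.card_eq_sum_ones]
    push_cast
    rw [Finset.mul_sum, Finset.mul_sum, ← Finset.sum_add_distrib]
    refine Finset.sum_congr rfl fun f hf => ?_
    rcases hS f hf with h | h
    · simp [h]
    · simp [h, hε1.ne']
  have hle : ε ≤ c e := by rcases hA e he with h | h <;> linarith
  have h1 : (#A : ℝ) ≤ #B + 1 := by exact_mod_cast hcard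
  have h2 : (#{e ∈ A | c e ≠ ε} : ℝ) ≤ #{e ∈ B | c e ≠ ε} := by exact_mod_cast hlarge
  rw [Finset.sum_erase_eq_sub he, key A hA, key B hB]
  nlinarith [mul_le_mul_of_nonneg_left h1 hε0,
    mul_le_mul_of_nonneg_left h2 (sub_nonneg.2 hε1.le)]

open Classical in
/-- The cost type of an item. -/
noncomputable def costType {ι : Type*} (c : Fin 3 → ι → ℝ) (ε : ℝ) (e : ι) : CostType :=
  (decide (c 0 e = ε), decide (c 1 e = ε), decide (c 2 e = ε))

lemma large_costType {ι : Type*} (c : Fin 3 → ι → ℝ) (ε : ℝ) (e : ι) (i : Fin 3) :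
    large i (costType c ε e) = true ↔ c i e ≠ ε := by
  fin_cases i <;> simp [large, costType]

lemma exists_efx_of_distinguished {ι : Type*} [DecidableEq ι] (M : Finset ι)
    (c : Fin 3 → ι → ℝ) (ε : ℝ) (hε0 : 0 ≤ ε) (hε1 : ε < 1)
    (hbi : ∀ i, ∀ e ∈ M, c i e = ε ∨ c i e = 1)
    {e f : ι} (he : e ∈ M) (hf : f ∈ M) (he0 : c 0 e = ε) (he1 : c 1 e ≠ ε) (he2 : c 2 e ≠ ε)
    (hf1 : c 1 f = ε) (hf2 : c 2 f ≠ ε) :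
    ∃ X : Fin 3 → Finset ι,
      (∀ i j, i ≠ j → Disjoint (X i) (X j)) ∧
      (Finset.univ.biUnion X = M) ∧
      (∀ i j : Fin 3, ∀ e ∈ X i,
        ∑ f ∈ (X i).erase e, c i f ≤ ∑ f ∈ X j, c i f) := by
  have hfe : f ∈ M.erase e := by
    refine Finset.mem_erase.2 ⟨?_, hf⟩
    rintro rfl
    exact he1 hf1
  have hsplit : Splittable (M.val.map (costType c ε)) := by
    have hM : M.val = e ::ₘ f ::ₘ ((M.erase e).erase f).val := by
      rw [Finset.erase_val, Multiset.cons_erase hfe, Finset.erase_val, Multiset.cons_erase he]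
    have h := splittable_of_distinguished (((M.erase e).erase f).val.map (costType c ε))
      (costType c ε f).1
    rw [hM, Multiset.map_cons, Multiset.map_cons]
    convert h using 1
    have hte : costType c ε e = (true, false, false) := by simp [costType, he0, he1, he2]
    have htf : costType c ε f = ((costType c ε f).1, true, false) := by
      simp [costType, hf1, hf2]
    rw [hte, htf, add_assoc, Multiset.singleton_add, Multiset.singleton_add]
  obtain ⟨Y, hsum, hY⟩ := hsplit
  obtain ⟨X, hdisj, hunion, hX⟩ :=
    Finset.exists_partition_of_map_eq_sum (costType c ε) Y M hsum.symm
  refine ⟨X, hdisj, hunion, fun i j g hg => ?_⟩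
  have hsub : ∀ k, X k ⊆ M := fun k => hunion ▸ Finset.subset_biUnion_of_mem X (mem_univ k)
  have hcard : ∀ k, (Y k).card = #(X k) := fun k => by
    rw [← hX k, Multiset.card_map, Finset.card_val]
  have hlarge : ∀ k, (Y k).countP (large i ·) = #{e ∈ X k | c i e ≠ ε} := fun k => by
    rw [← hX k, Multiset.countP_map, Finset.card_def, Finset.filter_val]
    simp only [large_costType]
  have h := hY i j
  rw [hcard, hcard, hlarge, hlarge] at h
  exact sum_erase_le_sum hε0 hε1 (fun e he => hbi i e (hsub i he))
    (fun e he => hbi i e (hsub j he)) h.1 h.2 hg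


/-- 3 agents with additive bi-valued cost functions taking values in `{ε, 1}` with
`0 ≤ ε < 1`, no two agents having identical cost functions.  If some item is small
only to some agent (it costs `ε` to that agent and `1` to both others), then there
exists an EFX allocation. -/
theorem stmt_14 {ι : Type*} [DecidableEq ι] (M : Finset ι)
    (c : Fin 3 → ι → ℝ) (ε : ℝ) (hε0 : 0 ≤ ε) (hε1 : ε < 1)
    (hbi : ∀ i, ∀ e ∈ M, c i e = ε ∨ c i e = 1)
    (hdiff : ∀ i j : Fin 3, i ≠ j → ∃ e ∈ M, c i e ≠ c j e)
    (hsmallonly : ∃ e ∈ M, ∃ i : Fin 3, c i e = ε ∧ ∀ j, j ≠ i → c j e = 1) :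
    ∃ X : Fin 3 → Finset ι,
      (∀ i j, i ≠ j → Disjoint (X i) (X j)) ∧
      (Finset.univ.biUnion X = M) ∧
      (∀ i j : Fin 3, ∀ e ∈ X i,
        ∑ f ∈ (X i).erase e, c i f ≤ ∑ f ∈ X j, c i f) := by
  obtain ⟨e, he, i, hei, hej⟩ := hsmallonly
  suffices H : ∃ σ : Equiv.Perm (Fin 3), σ 0 = i ∧ ∃ f ∈ M, c (σ 1) f = ε ∧ c (σ 2) f ≠ ε by
    obtain ⟨σ, hσ, f, hf, hf1, hf2⟩ := H
    have hne : ∀ j, j ≠ 0 → c (σ j) e ≠ ε := fun j hj => by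
      rw [hej _ fun h => hj (σ.injective (h.trans hσ.symm))]
      exact hε1.ne'
    obtain ⟨X, hdisj, hunion, hX⟩ := exists_efx_of_distinguished M (fun j => c (σ j)) ε hε0 hε1
      (fun j => hbi (σ j)) he hf (hσ ▸ hei) (hne 1 (by decide)) (hne 2 (by decide)) hf1 hf2
    refine ⟨X ∘ σ.symm, fun j k hjk => hdisj _ _ (σ.symm.injective.ne hjk), ?_, fun j k g hg => ?_⟩
    · rw [← hunion]
      ext g
      simp only [mem_biUnion, mem_univ, true_and, Function.comp_apply]
      exact (σ.symm.surjective.exists (p := fun j => g ∈ X j)).symm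
    · simpa using hX (σ.symm j) (σ.symm k) g hg
  set τ := Equiv.swap (0 : Fin 3) i
  have hτ : τ 0 = i := Equiv.swap_apply_left _ _
  obtain ⟨f, hf, hne⟩ := hdiff (τ 1) (τ 2) (τ.injective.ne (by decide))
  by_cases h1 : c (τ 1) f = ε
  · exact ⟨τ, hτ, f, hf, h1, fun h => hne (h1.trans h.symm)⟩
  · have h1' := (hbi (τ 1) f hf).resolve_left h1
    have h2 := (hbi (τ 2) f hf).resolve_right fun h => hne (h1'.trans h.symm)
    refine ⟨(Equiv.swap 1 2).trans τ, ?_, f, hf, by simpa using h2, by simpa using h1⟩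
    rw [Equiv.trans_apply, Equiv.swap_apply_of_ne_of_ne (a := 1) (b := 2) (x := (0 : Fin 3))
      (by decide) (by decide), hτ]
end
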